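/- arXiv:2509.13198 — 12 statements merged into one kernel-verified Lean document; each statement's English description precedes it below -/
import Mathlib

section
/- Let (p, (B_1,…,B_n)) be a CERI. Then there exists a Borel probability measure W on [0,∞)^n whose i-th one-dimensional marginal equals B_i for every agent i, and such that for W-almost every w = (w_1,…,w_n), the demanded allocation satisfies Σ_{i=1}^n D_i(p, w_i) ≤ c + (Δ−1)·1 coordinatewise. That is, every CERI has a (Δ−1)-near-feasible ex-post implementation: a lottery over deterministic allocations, each consisting of every agent's demanded bundle at the common CERI price vector p under a realized budget, whose budget marginals coincide with the B_i and all of whose supporting allocations exceed capacity by at most Δ−1 units of each good. -/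
open MeasureTheory Finset

noncomputable section

/-- A bundle of the `m` goods. -/
abbrev Bundle (m : ℕ) := Fin m → ℕ

/-- The price of bundle `x` at price vector `p`. -/
def dotp {m : ℕ} (p : Fin m → ℝ) (x : Bundle m) : ℝ := ∑ j, p j * (x j : ℝ)

/-- If every good in `T` can be overloaded by `Δ` or more within the support of the fractional
assignment `a`, and `a` is not integral, then `a` can be perturbed within its support without
changing the row sums or the loads of the goods in `T`. -/
theorem exists_load_preserving_direction {I K G : Type*} [Fintype I] [Fintype K] [Fintype G]
    [DecidableEq I] [DecidableEq K] [DecidableEq G] (s : K → G → ℕ) {Δ : ℕ} (hΔ : 0 < Δ)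
    (hs : ∀ k, ∑ g, s k g ≤ Δ) (T : Finset G) (a : I → K → ℝ) (ha : ∀ i k, 0 ≤ a i k)
    (hsum : ∀ i, ∑ k, a i k = 1)
    (hT : ∀ g ∈ T, ∃ y : I → K, (∀ i, a i (y i) ≠ 0) ∧
      ∑ i, ∑ k, a i k * (s k g : ℝ) + Δ ≤ ∑ i, (s (y i) g : ℝ))
    (hfrac : ∃ i k, a i k ≠ 0 ∧ a i k ≠ 1) :
    ∃ v : I → K → ℝ, v ≠ 0 ∧ (∀ i k, a i k = 0 → v i k = 0) ∧ (∀ i, ∑ k, v i k = 0) ∧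
      ∀ g ∈ T, ∑ i, ∑ k, v i k * (s k g : ℝ) = 0 := by
  set S : Finset (I × K) := univ.filter fun x => a x.1 x.2 ≠ 0 with hS
  have hmem : ∀ x : I × K, x ∈ S ↔ a x.1 x.2 ≠ 0 := by simp [hS]
  have hle1 : ∀ i k, a i k ≤ 1 := fun i k => by
    rw [← hsum i]; exact single_le_sum (fun k _ => ha i k) (mem_univ k)
  have hsT : ∀ k, ∑ g ∈ T, (s k g : ℝ) ≤ Δ := fun k => by
    have : ∑ g ∈ T, s k g ≤ Δ :=
      (sum_le_sum_of_subset (subset_univ T)).trans (hs k)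
    exact_mod_cast this
  have hSsum : ∀ f : I → K → ℝ, (∀ i k, a i k = 0 → f i k = 0) →
      ∑ x ∈ S, f x.1 x.2 = ∑ i, ∑ k, f i k := by
    intro f hf
    rw [← Fintype.sum_prod_type']
    refine sum_subset (subset_univ S) fun x _ hx => hf _ _ ?_
    simpa [hmem] using hx
  have hgood : ∀ g ∈ T, (Δ : ℝ) ≤ ∑ x ∈ S, (1 - a x.1 x.2) * (s x.2 g : ℝ) := by
    intro g hg
    obtain ⟨y, hy, hload⟩ := hT g hg
    have h1 : ∑ i, (s (y i) g : ℝ) ≤ ∑ x ∈ S, (s x.2 g : ℝ) := by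
      have hinj : Function.Injective fun i => (i, y i) := fun i j h => (Prod.ext_iff.1 h).1
      have : ∑ x ∈ univ.image (fun i => (i, y i)), (s x.2 g : ℝ) = ∑ i, (s (y i) g : ℝ) :=
        sum_image hinj.injOn
      rw [← this]
      refine sum_le_sum_of_subset_of_nonneg ?_ fun _ _ _ => by positivity
      intro x hx
      obtain ⟨i, -, rfl⟩ := mem_image.1 hx
      exact (hmem _).2 (hy i)
    have h2 := hSsum (fun i k => a i k * (s k g : ℝ)) (by intro i k h; simp [h])
    simp only [sub_mul, one_mul, sum_sub_distrib]
    linarith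
  have hcardsum : ∑ x ∈ S, (1 - a x.1 x.2) = (S.card : ℝ) - Fintype.card I := by
    rw [sum_sub_distrib, hSsum a fun _ _ h => h]
    simp [hsum]
  have hslack : ∀ x ∈ S, 0 ≤ (1 - a x.1 x.2) * ((Δ : ℝ) - ∑ g ∈ T, (s x.2 g : ℝ)) := fun x _ =>
    mul_nonneg (sub_nonneg.2 (hle1 _ _)) (sub_nonneg.2 (hsT _))
  have hslack_sum : ∑ x ∈ S, (1 - a x.1 x.2) * ((Δ : ℝ) - ∑ g ∈ T, (s x.2 g : ℝ)) ≤
      ((S.card : ℝ) - Fintype.card I - T.card) * Δ := by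
    have h1 : (T.card : ℝ) * Δ ≤ ∑ g ∈ T, ∑ x ∈ S, (1 - a x.1 x.2) * (s x.2 g : ℝ) := by
      rw [← nsmul_eq_mul]
      exact card_nsmul_le_sum _ _ _ hgood
    rw [sum_comm] at h1
    simp only [mul_sub, sum_sub_distrib, ← sum_mul, hcardsum, mul_sum]
    linarith
  have hΔ' : (0 : ℝ) < Δ := by exact_mod_cast hΔ
  have hcard : Fintype.card I + T.card ≤ S.card := by
    have h := (sum_nonneg hslack).trans hslack_sum
    have : (Fintype.card I : ℝ) + T.card ≤ S.card := by
      have := nonneg_of_mul_nonneg_left h hΔ'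
      linarith
    exact_mod_cast this
  let L : (S → ℝ) →ₗ[ℝ] (I ⊕ T → ℝ) :=
    { toFun := fun f => Sum.elim
        (fun i => ∑ x : S, if x.1.1 = i then f x else 0)
        (fun g => ∑ x : S, f x * (s x.1.2 g.1 : ℝ))
      map_add' := by
        intro f f'
        ext (i | g)
        · simp [← sum_add_distrib, ← ite_add_zero]
        · simp [← sum_add_distrib, add_mul]
      map_smul' := by
        intro r f
        ext (i | g)
        · simp [mul_sum]
        · simp [mul_sum, mul_assoc] }
  have hLI : ∀ f i, L f (Sum.inl i) = ∑ x : S, if x.1.1 = i then f x else 0 := fun _ _ => rfl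
  have hLT : ∀ f g, L f (Sum.inr g) = ∑ x : S, f x * (s x.1.2 g.1 : ℝ) := fun _ _ => rfl
  have hker : ∃ f, f ≠ 0 ∧ L f = 0 := by
    by_contra! hno
    have hinj : Function.Injective L := by
      rw [injective_iff_map_eq_zero]
      intro f hf
      by_contra h
      exact hno f h hf
    have hdim := LinearMap.finrank_le_finrank_of_injective hinj
    simp only [Module.finrank_fintype_fun_eq_card, Fintype.card_sum, Fintype.card_coe] at hdim
    have heq : S.card = Fintype.card I + T.card := le_antisymm hdim hcard
    have hsurj : Function.Surjective L :=
      (LinearMap.injective_iff_surjective_of_finrank_eq_finrank (by simp [heq])).1 hinj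
    have htight : ∀ x ∈ S, (1 - a x.1 x.2) * ((Δ : ℝ) - ∑ g ∈ T, (s x.2 g : ℝ)) = 0 := by
      refine (sum_eq_zero_iff_of_nonneg hslack).1 (le_antisymm ?_ (sum_nonneg hslack))
      refine hslack_sum.trans (le_of_eq ?_)
      rw [heq]; push_cast; ring
    obtain ⟨i₀, k₀, h0, h1⟩ := hfrac
    have hTne : T.Nonempty := by
      rw [nonempty_iff_ne_empty]
      rintro rfl
      have := htight (i₀, k₀) ((hmem _).2 h0)
      simp only [sum_empty, sub_zero, mul_eq_zero, hΔ'.ne', or_false] at this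
      exact h1 (by linarith)
    have hconst : ∀ i, ∃ t : ℝ, ∀ k, a i k ≠ 0 → ∑ g ∈ T, (s k g : ℝ) = t := by
      intro i
      by_cases h : ∃ k, a i k = 1
      · obtain ⟨k, hk⟩ := h
        refine ⟨∑ g ∈ T, (s k g : ℝ), fun k' hk' => ?_⟩
        by_cases hkk : k' = k
        · rw [hkk]
        · exfalso
          have h2 : a i k' + a i k ≤ 1 := by
            rw [← sum_pair hkk, ← hsum i]
            exact sum_le_sum_of_subset_of_nonneg (subset_univ _) fun k _ _ => ha i k
          exact hk' (le_antisymm (by linarith) (ha i k'))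
      · push Not at h
        refine ⟨Δ, fun k hk => ?_⟩
        rcases mul_eq_zero.1 (htight (i, k) ((hmem _).2 hk)) with h' | h'
        · exact absurd (by simpa using (sub_eq_zero.1 h').symm) (h k)
        · exact (sub_eq_zero.1 h').symm
    choose t ht using hconst
    obtain ⟨g₀, hg₀⟩ := hTne
    obtain ⟨f, hf⟩ := hsurj (Pi.single (Sum.inr ⟨g₀, hg₀⟩) 1)
    have hone : ∑ g : T, L f (Sum.inr g) = 1 := by
      rw [hf]; simp [Pi.single_apply]
    have hzero : ∑ g : T, L f (Sum.inr g) = ∑ i, t i * L f (Sum.inl i) := by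
      simp only [hLI, hLT, mul_sum]
      rw [sum_comm, sum_comm (s := (univ : Finset I))]
      refine sum_congr rfl fun x _ => ?_
      rw [← mul_sum, sum_coe_sort T fun g => (s x.1.2 g : ℝ), ht x.1.1 x.1.2 ((hmem _).1 x.2)]
      simp [mul_comm]
    rw [hone, hf] at hzero
    simp at hzero
  obtain ⟨f, hf0, hLf⟩ := hker
  let v : I → K → ℝ := fun i k => if h : (i, k) ∈ S then f ⟨(i, k), h⟩ else 0
  have hv0 : ∀ i k, a i k = 0 → v i k = 0 := by
    intro i k h
    have : (i, k) ∉ S := by simp [hmem, h]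
    simp [v, this]
  have hvS : ∀ x : S, v x.1.1 x.1.2 = f x := fun x => by simp [v]
  refine ⟨v, ?_, hv0, ?_, ?_⟩
  · intro h
    apply hf0
    ext x
    rw [← hvS x, h]; rfl
  · intro i
    have h1 := congrFun hLf (Sum.inl i)
    rw [hLI] at h1
    have h2 := hSsum (fun i' k => if i' = i then v i' k else 0)
      (by intro i' k h; simp [hv0 i' k h])
    rw [← sum_coe_sort] at h2
    simp only [hvS] at h2
    rw [h1] at h2
    rw [sum_comm] at h2
    simpa using h2.symm
  · intro g hg
    have h1 := congrFun hLf (Sum.inr ⟨g, hg⟩)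
    rw [hLT] at h1
    have h2 := hSsum (fun i k => v i k * (s k g : ℝ)) (by intro i k h; simp [hv0 i k h])
    rw [← sum_coe_sort] at h2
    simp only [hvS] at h2
    rw [← h2, h1]; rfl

/-- Moving a nonnegative array along a direction with a negative entry until an entry of its
support vanishes. -/
theorem exists_step_to_boundary {X : Type*} [Fintype X] (a v : X → ℝ) (ha : ∀ x, 0 ≤ a x)
    (hav : ∀ x, a x = 0 → v x = 0) (hneg : ∃ x, v x < 0) :
    ∃ t > 0, (∀ x, 0 ≤ a x + t * v x) ∧ ∃ x, a x ≠ 0 ∧ a x + t * v x = 0 := by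
  classical
  obtain ⟨x, hx, hmin⟩ := exists_min_image (univ.filter fun x => v x < 0)
    (fun x => a x / -v x) (by obtain ⟨x, hx⟩ := hneg; exact ⟨x, by simpa using hx⟩)
  have hvx : v x < 0 := by simpa using hx
  have hax : a x ≠ 0 := fun h => hvx.ne (hav x h)
  have hpos : 0 < a x / -v x := div_pos (lt_of_le_of_ne (ha x) hax.symm) (neg_pos.2 hvx)
  refine ⟨a x / -v x, hpos, fun z => ?_, x, hax, ?_⟩
  · by_cases hz : v z < 0
    · have h := hmin z (by simpa using hz)
      rw [le_div_iff₀ (neg_pos.2 hz)] at h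
      linarith
    · exact add_nonneg (ha z) (mul_nonneg hpos.le (not_lt.1 hz))
  · rw [div_neg, neg_mul, div_mul_cancel₀ _ hvx.ne, add_neg_cancel]

/-- A fractional assignment is the marginal of a lottery over integral assignments whose load on
each good of `T` exceeds the fractional load by less than `Δ`. -/
theorem exists_lottery_load_lt {I K G : Type*} [Fintype I] [Fintype K] [Fintype G]
    [DecidableEq I] [DecidableEq K] [DecidableEq G] (s : K → G → ℕ) {Δ : ℕ} (hΔ : 0 < Δ)
    (hs : ∀ k, ∑ g, s k g ≤ Δ) (T : Finset G) (a : I → K → ℝ) (ha : ∀ i k, 0 ≤ a i k)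
    (hsum : ∀ i, ∑ k, a i k = 1) :
    ∃ q : (I → K) → ℝ, (∀ y, 0 ≤ q y) ∧ ∑ y, q y = 1 ∧
      (∀ i k, (∑ y, if y i = k then q y else 0) = a i k) ∧
      ∀ y, q y ≠ 0 → (∀ i, a i (y i) ≠ 0) ∧
        ∀ g ∈ T, ∑ i, (s (y i) g : ℝ) < ∑ i, ∑ k, a i k * (s k g : ℝ) + Δ := by
  induction hN : T.card + (univ.filter fun x : I × K => a x.1 x.2 ≠ 0).card
    using Nat.strong_induction_on generalizing T a with
  | _ N ih =>
  subst hN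
  by_cases hdrop : ∃ g ∈ T, ∀ y : I → K, (∀ i, a i (y i) ≠ 0) →
      ∑ i, (s (y i) g : ℝ) < ∑ i, ∑ k, a i k * (s k g : ℝ) + Δ
  · obtain ⟨g, hg, hdrop⟩ := hdrop
    obtain ⟨q, hq0, hq1, hqa, hq⟩ := ih _
      (Nat.add_lt_add_right (card_erase_lt_of_mem hg) _) (T.erase g) a ha hsum rfl
    refine ⟨q, hq0, hq1, hqa, fun y hy => ⟨(hq y hy).1, fun g' hg' => ?_⟩⟩
    by_cases h : g' = g
    · subst h
      exact hdrop y (hq y hy).1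
    · exact (hq y hy).2 g' (mem_erase.2 ⟨h, hg'⟩)
  push Not at hdrop
  by_cases hfrac : ∃ i k, a i k ≠ 0 ∧ a i k ≠ 1
  · obtain ⟨v, hv, hav, hvsum, hvload⟩ :=
      exists_load_preserving_direction s hΔ hs T a ha hsum hdrop hfrac
    have hneg : ∀ w : I → K → ℝ, w ≠ 0 → (∀ i, ∑ k, w i k = 0) → ∃ x : I × K, w x.1 x.2 < 0 := by
      intro w hw hwsum
      by_contra! h
      apply hw
      ext i k
      exact (sum_eq_zero_iff_of_nonneg fun k _ => h (i, k)).1 (hwsum i) k (mem_univ k)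
    have hmove : ∀ w : I → K → ℝ, w ≠ 0 → (∀ i k, a i k = 0 → w i k = 0) →
        (∀ i, ∑ k, w i k = 0) → (∀ g ∈ T, ∑ i, ∑ k, w i k * (s k g : ℝ) = 0) →
        ∃ t > 0, ∃ q : (I → K) → ℝ, (∀ y, 0 ≤ q y) ∧ ∑ y, q y = 1 ∧
          (∀ i k, (∑ y, if y i = k then q y else 0) = a i k + t * w i k) ∧
          ∀ y, q y ≠ 0 → (∀ i, a i (y i) ≠ 0) ∧
            ∀ g ∈ T, ∑ i, (s (y i) g : ℝ) < ∑ i, ∑ k, a i k * (s k g : ℝ) + Δ := by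
      intro w hw haw hwsum hwload
      obtain ⟨t, ht, hnn, x, hax, hx⟩ := exists_step_to_boundary
        (fun x : I × K => a x.1 x.2) (fun x => w x.1 x.2) (fun x => ha _ _)
        (fun x => haw _ _) (hneg w hw hwsum)
      have hcard : (univ.filter fun x : I × K => a x.1 x.2 + t * w x.1 x.2 ≠ 0).card <
          (univ.filter fun x : I × K => a x.1 x.2 ≠ 0).card := by
        refine card_lt_card ⟨fun z hz => ?_, fun h => ?_⟩
        · simp only [mem_filter, mem_univ, true_and] at hz ⊢
          exact fun h => hz (by simp [h, haw _ _ h])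
        · have := h (mem_filter.2 ⟨mem_univ x, hax⟩)
          simp [hx] at this
      obtain ⟨q, hq0, hq1, hqa, hq⟩ := ih _ (Nat.add_lt_add_left hcard _) T
        (fun i k => a i k + t * w i k) (fun i k => hnn (i, k))
        (fun i => by rw [sum_add_distrib, ← mul_sum, hwsum, hsum]; simp) rfl
      refine ⟨t, ht, q, hq0, hq1, hqa, fun y hy => ⟨fun i h => ?_, fun g hg => ?_⟩⟩
      · exact (hq y hy).1 i (by simp [h, haw _ _ h])
      · have := (hq y hy).2 g hg
        simpa only [add_mul, sum_add_distrib, mul_assoc, ← mul_sum, hwload g hg, mul_zero,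
          add_zero] using this
    obtain ⟨t, ht, q, hq0, hq1, hqa, hq⟩ := hmove v hv hav hvsum hvload
    obtain ⟨u, hu, r, hr0, hr1, hra, hr⟩ := hmove (-v) (neg_ne_zero.2 hv)
      (fun i k h => by simp [hav i k h]) (fun i => by simp [hvsum])
      (fun g hg => by simp [hvload g hg])
    have htu : t + u ≠ 0 := (add_pos ht hu).ne'
    refine ⟨fun y => u / (t + u) * q y + t / (t + u) * r y, fun y => ?_, ?_, fun i k => ?_,
      fun y hy => ?_⟩
    · have := hq0 y
      have := hr0 y
      positivity
    · rw [sum_add_distrib, ← mul_sum, ← mul_sum, hq1, hr1]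
      field_simp
      ring
    · have : ∀ y : I → K, (if y i = k then u / (t + u) * q y + t / (t + u) * r y else 0) =
          u / (t + u) * (if y i = k then q y else 0) +
            t / (t + u) * (if y i = k then r y else 0) := by
        intro y; split_ifs <;> simp
      simp only [this]
      rw [sum_add_distrib, ← mul_sum, ← mul_sum, hqa, hra]
      simp only [Pi.neg_apply]
      field_simp
      ring
    · by_cases h : q y = 0
      · refine hr y fun h' => hy ?_
        simp [h, h']
      · exact hq y h
  · push Not at hfrac
    have hex : ∀ i, ∃ k, a i k ≠ 0 := by
      intro i
      by_contra! h
      simpa [h] using hsum i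
    choose y hy using hex
    have hay : ∀ i k, a i k = if y i = k then 1 else 0 := by
      intro i k
      split_ifs with h
      · rw [← h]; exact hfrac i _ (hy i)
      · by_contra hk
        have h2 : a i (y i) + a i k ≤ 1 := by
          rw [← sum_pair h, ← hsum i]
          exact sum_le_sum_of_subset_of_nonneg (subset_univ _) fun k _ _ => ha i k
        rw [hfrac i _ (hy i), hfrac i k hk] at h2
        norm_num at h2
    refine ⟨fun z => if z = y then 1 else 0, fun z => by dsimp only; split_ifs <;> norm_num, by simp,
      fun i k => ?_, fun z hz => ?_⟩
    · rw [hay, sum_eq_single y] <;> simp +contextual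
    · have hzy : z = y := by simpa using hz
      subst hzy
      refine ⟨hy, fun g _ => ?_⟩
      simp [hay, hΔ]

/-- A lottery over profiles of cells, with the right marginal cell probabilities, lifts to a joint
distribution with the given marginals that almost surely lies in the cells of a profile drawn by
the lottery. -/
theorem exists_joint_measure_of_lottery {I K X : Type*} [Fintype I] [Fintype K]
    [DecidableEq I] [DecidableEq K] [MeasurableSpace X] (B : I → Measure X)
    [∀ i, IsProbabilityMeasure (B i)] (A : I → K → Set X) (hA : ∀ i k, MeasurableSet (A i k))
    (hdisj : ∀ i, Pairwise fun k l => Disjoint (A i k) (A i l))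
    (hcov : ∀ i, ∀ᵐ x ∂B i, x ∈ ⋃ k, A i k)
    (q : (I → K) → ℝ) (hq0 : ∀ y, 0 ≤ q y) (hq1 : ∑ y, q y = 1)
    (hq : ∀ i k, (∑ y, if y i = k then q y else 0) = (B i).real (A i k)) :
    ∃ W : Measure (I → X), IsProbabilityMeasure W ∧ (∀ i, W.map (fun w => w i) = B i) ∧
      ∀ᵐ w ∂W, ∃ y, q y ≠ 0 ∧ ∀ i, w i ∈ A i (y i) := by
  have hν : ∀ i k, ∃ ν : Measure X, IsProbabilityMeasure ν ∧
      B i (A i k) • ν = (B i).restrict (A i k) ∧ (B i (A i k) ≠ 0 → ∀ᵐ x ∂ν, x ∈ A i k) := by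
    intro i k
    by_cases h : B i (A i k) = 0
    · exact ⟨B i, inferInstance, by simp [h, Measure.restrict_eq_zero.2 h], fun h' => absurd h h'⟩
    · refine ⟨ProbabilityTheory.cond (B i) (A i k),
        ProbabilityTheory.cond_isProbabilityMeasure h, ?_, fun _ => ?_⟩
      · rw [ProbabilityTheory.cond, smul_smul, ENNReal.mul_inv_cancel h (measure_ne_top _ _),
          one_smul]
      · exact ProbabilityTheory.ae_cond_mem (hA i k)
  choose ν hνprob hνsmul hνmem using hν
  have hpos : ∀ y, q y ≠ 0 → ∀ i, B i (A i (y i)) ≠ 0 := by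
    intro y hy i h
    have h1 := hq i (y i)
    rw [measureReal_def, h, ENNReal.toReal_zero,
      sum_eq_zero_iff_of_nonneg fun z _ => by split_ifs <;> simp [hq0]] at h1
    exact hy (by simpa using h1 y (mem_univ y))
  have hcoef : ∀ i k, (∑ y, if y i = k then ENNReal.ofReal (q y) else 0) = B i (A i k) := by
    intro i k
    rw [← ENNReal.ofReal_toReal (measure_ne_top (B i) (A i k)), ← measureReal_def, ← hq i k,
      ENNReal.ofReal_sum_of_nonneg fun z _ => by split_ifs <;> simp [hq0]]
    exact sum_congr rfl fun y _ => by split_ifs <;> simp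
  refine ⟨∑ y, ENNReal.ofReal (q y) • Measure.pi fun i => ν i (y i), ⟨?_⟩, fun i => ?_, ?_⟩
  · rw [Measure.finsetSum_apply]
    simp only [Measure.smul_apply, measure_univ, smul_eq_mul, mul_one]
    rw [← ENNReal.ofReal_sum_of_nonneg fun y _ => hq0 y, hq1, ENNReal.ofReal_one]
  · have hmap : ∀ y : I → K, (Measure.pi fun i => ν i (y i)).map (fun w => w i) = ν i (y i) := by
      intro y
      have := Measure.pi_map_eval (μ := fun i => ν i (y i)) i
      simpa [Function.eval] using this
    have hm : Measurable fun w : I → X => w i := measurable_pi_apply i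
    have hrestr : ∑ k, (B i).restrict (A i k) = B i := by
      rw [← Measure.sum_fintype, ← Measure.restrict_iUnion (hdisj i) (hA i)]
      exact Measure.restrict_eq_self_of_ae_mem (hcov i)
    rw [← Measure.mapₗ_apply_of_measurable hm, map_sum]
    simp only [Measure.mapₗ_apply_of_measurable hm, Measure.map_smul, hmap]
    calc ∑ y, ENNReal.ofReal (q y) • ν i (y i)
        = ∑ y, ∑ k, (if y i = k then ENNReal.ofReal (q y) else 0) • ν i k := by
          simp [ite_smul]
      _ = ∑ k, B i (A i k) • ν i k := by
          rw [sum_comm]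
          simp only [← sum_smul, hcoef]
      _ = B i := by simp only [hνsmul, hrestr]
  · rw [← Measure.sum_fintype, Measure.ae_sum_iff]
    intro y
    by_cases hy : q y = 0
    · simp [hy]
    · refine Measure.ae_smul_measure ?_ _
      have : ∀ i, ∀ᵐ w ∂Measure.pi fun i => ν i (y i), w i ∈ A i (y i) := fun i =>
        Measure.tendsto_eval_ae_ae.eventually (hνmem i (y i) (hpos y hy i))
      filter_upwards [ae_all_iff.2 this] with w hw using ⟨y, hy, hw⟩

/-- **Implementability** (Theorem 2): every CERI has a `(Δ-1)`-near-feasible ex-post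
implementation: a joint income distribution `W` on `[0,∞)^n` whose `i`-th marginal is `B i`,
such that almost surely the allocation of demanded bundles at the common CERI price vector
exceeds capacity by at most `Δ - 1` units of each good. -/
theorem ceri_near_feasible_implementation
    (n m Δ : ℕ) (hΔ : 0 < Δ)
    (c : Fin m → ℕ)
    (Ψ : Fin n → Finset (Bundle m))
    (hzero : ∀ i, (0 : Bundle m) ∈ Ψ i)
    (hsize : ∀ i, ∀ x ∈ Ψ i, ∑ j, x j ≤ Δ)
    (pref : Fin n → Bundle m → Bundle m → Prop)
    (hirr : ∀ i, ∀ x ∈ Ψ i, ¬ pref i x x)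
    (htrans : ∀ i, ∀ x ∈ Ψ i, ∀ y ∈ Ψ i, ∀ z ∈ Ψ i,
        pref i x y → pref i y z → pref i x z)
    (htotal : ∀ i, ∀ x ∈ Ψ i, ∀ y ∈ Ψ i, x ≠ y → pref i x y ∨ pref i y x)
    (hleast : ∀ i, ∀ x ∈ Ψ i, x ≠ 0 → pref i x 0)
    (D : Fin n → (Fin m → ℝ) → ℝ → Bundle m)
    (hD : ∀ (i : Fin n) (p : Fin m → ℝ) (b : ℝ), (∀ j, 0 ≤ p j) → 0 ≤ b →
        D i p b ∈ Ψ i ∧ dotp p (D i p b) ≤ b ∧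
        ∀ x ∈ Ψ i, dotp p x ≤ b → x = D i p b ∨ pref i (D i p b) x)
    (B : Fin n → Measure ℝ)
    (hBprob : ∀ i, IsProbabilityMeasure (B i))
    (hBnonneg : ∀ i, B i {b | b < 0} = 0)
    -- the CERI conditions for price vector `p`
    (p : Fin m → ℝ) (hp : ∀ j, 0 ≤ p j)
    (hmarket_le : ∀ j,
        ∑ i, ∑ x ∈ Ψ i, (B i {b | D i p b = x}).toReal * (x j : ℝ) ≤ (c j : ℝ))
    (hmarket_eq : ∀ j, 0 < p j →
        ∑ i, ∑ x ∈ Ψ i, (B i {b | D i p b = x}).toReal * (x j : ℝ) = (c j : ℝ)) :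
    ∃ W : Measure (Fin n → ℝ), IsProbabilityMeasure W ∧
      (∀ i, W.map (fun w => w i) = B i) ∧
      ∀ᵐ w ∂W, (∀ i, 0 ≤ w i) ∧ ∀ j, ∑ i, D i p (w i) j ≤ c j + (Δ - 1) := by
  classical
  let U : Finset (Bundle m) := univ.biUnion Ψ
  have hΨU : ∀ i, Ψ i ⊆ U := fun i => subset_biUnion_of_mem Ψ (mem_univ i)
  let A : Fin n → U → Set ℝ := fun i k => {b | 0 ≤ b ∧ D i p b = k.1}
  have hDeq : ∀ i b, 0 ≤ b → ∀ x, D i p b = x ↔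
      x ∈ Ψ i ∧ dotp p x ≤ b ∧ ∀ z ∈ Ψ i, dotp p z ≤ b → z = x ∨ pref i x z := by
    intro i b hb x
    obtain ⟨h1, h2, h3⟩ := hD i p b hp hb
    refine ⟨fun h => h ▸ ⟨h1, h2, h3⟩, fun ⟨hx, hxb, hbest⟩ => ?_⟩
    rcases h3 x hx hxb with h | h
    · exact h.symm
    rcases hbest _ h1 h2 with h' | h'
    · exact h'
    · exact absurd (htrans i _ hx _ h1 _ hx h' h) (hirr i x hx)
  have hA : ∀ i k, MeasurableSet (A i k) := by
    intro i k
    have : A i k = {b : ℝ | 0 ≤ b ∧ k.1 ∈ Ψ i ∧ dotp p k.1 ≤ b ∧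
        ∀ z ∈ Ψ i, dotp p z ≤ b → z = k.1 ∨ pref i k.1 z} := by
      ext b
      exact and_congr_right fun hb => hDeq i b hb k.1
    rw [this]
    refine measurableSet_Ici.inter ((MeasurableSet.const _).inter (measurableSet_Ici.inter ?_))
    change MeasurableSet {b : ℝ | ∀ z ∈ Ψ i, dotp p z ≤ b → z = k.1 ∨ pref i k.1 z}
    simp only [Set.ofPred_forall]
    refine Finset.measurableSet_biInter _ fun z _ => ?_
    exact measurableSet_Ici.himp (MeasurableSet.const _)
  have hnn : ∀ i, ∀ᵐ b ∂B i, 0 ≤ b := fun i => by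
    rw [ae_iff]; simpa using hBnonneg i
  have hdisj : ∀ i, Pairwise fun k l => Disjoint (A i k) (A i l) := fun i k l hkl =>
    Set.disjoint_left.2 fun b hb hb' => hkl (Subtype.ext (hb.2.symm.trans hb'.2))
  have hcov : ∀ i, ∀ᵐ b ∂B i, b ∈ ⋃ k, A i k := by
    intro i
    filter_upwards [hnn i] with b hb
    exact Set.mem_iUnion.2 ⟨⟨D i p b, hΨU i (hD i p b hp hb).1⟩, hb, rfl⟩
  have hreal : ∀ i (k : U), (B i).real (A i k) = (B i {b | D i p b = k.1}).toReal := by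
    intro i k
    rw [measureReal_def]
    congr 1
    refine measure_congr ?_
    filter_upwards [hnn i] with b hb
    exact propext (and_iff_right hb)
  have hsum : ∀ i, ∑ k, (B i).real (A i k) = 1 := by
    intro i
    rw [← measureReal_iUnion_fintype (hdisj i) (hA i), measureReal_def,
      prob_compl_eq_zero_iff (MeasurableSet.iUnion (hA i)) |>.1 (hcov i), ENNReal.toReal_one]
  have hload : ∀ j, ∑ i, ∑ k : U, (B i).real (A i k) * (k.1 j : ℝ) ≤ c j := by
    intro j
    refine le_of_eq_of_le (sum_congr rfl fun i _ => ?_) (hmarket_le j)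
    simp only [hreal]
    rw [sum_coe_sort U fun x => (B i {b | D i p b = x}).toReal * (x j : ℝ)]
    refine (sum_subset (hΨU i) fun x _ hx => ?_).symm
    have : B i {b | D i p b = x} = 0 := by
      rw [← compl_compl {b | D i p b = x}]
      change ∀ᵐ b ∂B i, D i p b ≠ x
      filter_upwards [hnn i] with b hb h
      exact hx (h ▸ (hD i p b hp hb).1)
    simp [this]
  have hsU : ∀ k : U, ∑ j, k.1 j ≤ Δ := by
    intro k
    obtain ⟨i, -, hi⟩ := mem_biUnion.1 k.2
    exact hsize i _ hi
  obtain ⟨q, hq0, hq1, hqa, hq⟩ := exists_lottery_load_lt (fun k : U => k.1) hΔ hsU univ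
    (fun i k => (B i).real (A i k)) (fun _ _ => measureReal_nonneg) hsum
  obtain ⟨W, hW, hmarg, hae⟩ := exists_joint_measure_of_lottery B A hA hdisj hcov q hq0 hq1 hqa
  refine ⟨W, hW, hmarg, ?_⟩
  filter_upwards [hae] with w ⟨y, hy, hwy⟩
  refine ⟨fun i => (hwy i).1, fun j => ?_⟩
  have h := ((hq y hy).2 j (mem_univ j)).trans_le (add_le_add_left (hload j) (Δ : ℝ))
  have h' : ∑ i, (y i).1 j < c j + Δ := by exact_mod_cast h
  simp only [fun i => (hwy i).2]
  omega
end
end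

section
/- A feasible lottery allocation (x̃_1,…,x̃_n) is ordinally efficient if and only if it is a CERI allocation; that is, if and only if there exist budget distributions (B_1,…,B_n) and a price vector p ≥ 0 forming a CERI such that each x̃_i equals agent i's random demand at p. -/
open MeasureTheory Finset
open scoped Classical

noncomputable section

/-- The probability, under the finitely supported distribution `μ` on `Ψi`, of the
weak upper contour set of `z` for the strict order `pr`. -/
def upProb {m : ℕ} (Ψi : Finset (Bundle m)) (pr : Bundle m → Bundle m → Prop)
    (μ : Bundle m → ℝ) (z : Bundle m) : ℝ :=
  ∑ x ∈ Ψi, if x = z ∨ pr x z then μ x else 0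

/-- A finite strict total order is represented by a rank function. -/
lemma exists_rank {ι : Type*} (S : Finset ι) (pr : ι → ι → Prop)
    (hirr : ∀ x ∈ S, ¬ pr x x)
    (htrans : ∀ x ∈ S, ∀ y ∈ S, ∀ z ∈ S, pr x y → pr y z → pr x z)
    (htotal : ∀ x ∈ S, ∀ y ∈ S, x ≠ y → pr x y ∨ pr y x) :
    ∃ r : ι → ℕ, (∀ x ∈ S, ∀ y ∈ S, (pr x y ↔ r y < r x)) ∧
      ∀ x ∈ S, ∀ y ∈ S, r x = r y → x = y := by
  have key : ∀ x ∈ S, ∀ y ∈ S, pr x y → #{w ∈ S | pr y w} < #{w ∈ S | pr x w} := by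
    intro x hx y hy hxy
    refine card_lt_card ((ssubset_iff_of_subset fun w hw => ?_).2 ⟨y, ?_, ?_⟩)
    · rw [mem_filter] at hw ⊢
      exact ⟨hw.1, htrans x hx y hy w hw.1 hxy hw.2⟩
    · simp [hy, hxy]
    · simp [hirr y hy]
  refine ⟨fun x => #{w ∈ S | pr x w}, fun x hx y hy => ⟨key x hx y hy, fun h => ?_⟩,
    fun x hx y hy h => ?_⟩
  · rcases eq_or_ne x y with rfl | hne
    · exact absurd h (lt_irrefl _)
    · exact (htotal x hx y hy hne).resolve_right fun h' => lt_asymm h (key y hy x hx h')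
  · by_contra hne
    rcases htotal x hx y hy hne with h' | h'
    · exact (key x hx y hy h').ne' h
    · exact (key y hy x hx h').ne h

/-- A nonnegative monotone function on a finite chain is a nonnegative combination of indicators of
principal upper sets. -/
lemma exists_increments {ι : Type*} (r : ι → ℕ) (f : ι → ℝ) (S : Finset ι)
    (hinj : ∀ x ∈ S, ∀ y ∈ S, r x = r y → x = y) (hf : ∀ x ∈ S, 0 ≤ f x)
    (hmono : ∀ x ∈ S, ∀ y ∈ S, r x ≤ r y → f x ≤ f y) :
    ∃ d : ι → ℝ, (∀ z ∈ S, 0 ≤ d z) ∧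
      ∀ x ∈ S, f x = ∑ z ∈ S, if r z ≤ r x then d z else 0 := by
  induction S using Finset.induction_on_max_value r with
  | empty => exact ⟨0, by simp, by simp⟩
  | insert a s has hmax ih =>
    obtain ⟨d, hd, hfd⟩ := ih (fun x hx y hy => hinj x (mem_insert_of_mem hx) y
      (mem_insert_of_mem hy)) (fun x hx => hf x (mem_insert_of_mem hx))
      (fun x hx y hy => hmono x (mem_insert_of_mem hx) y (mem_insert_of_mem hy))
    have hle : ∑ z ∈ s, d z ≤ f a := by
      rcases s.eq_empty_or_nonempty with rfl | hs
      · simpa using hf a (by simp)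
      · obtain ⟨w, hw, hwmax⟩ := exists_max_image s r hs
        calc ∑ z ∈ s, d z = f w := by
              rw [hfd w hw]
              exact sum_congr rfl fun z hz => by rw [if_pos (hwmax z hz)]
          _ ≤ f a := hmono w (mem_insert_of_mem hw) a (mem_insert_self a s) (hmax w hw)
    have hne : ∀ z ∈ s, z ≠ a := fun z hz h => has (h ▸ hz)
    refine ⟨Function.update d a (f a - ∑ z ∈ s, d z), fun z hz => ?_, fun x hx => ?_⟩
    · rcases mem_insert.1 hz with rfl | hz
      · simpa using hle
      · simpa [hne z hz] using hd z hz
    · rw [sum_insert has]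
      have hsum : (∑ z ∈ s, if r z ≤ r x then
          Function.update d a (f a - ∑ z ∈ s, d z) z else 0) =
          ∑ z ∈ s, if r z ≤ r x then d z else 0 :=
        sum_congr rfl fun z hz => by simp [hne z hz]
      rw [hsum]
      rcases mem_insert.1 hx with rfl | hxs
      · have : (∑ z ∈ s, if r z ≤ r x then d z else 0) = ∑ z ∈ s, d z :=
          sum_congr rfl fun z hz => by rw [if_pos (hmax z hz)]
        simp [this]
      · have : ¬ r a ≤ r x := fun h => hne x hxs
          (hinj x hx a (mem_insert_self a s) (le_antisymm (hmax x hxs) h))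
        rw [if_neg this, zero_add]
        exact hfd x hxs

/-- If every outcome better than one in the support of `μ` costs strictly more, then a lottery `ν`
dominating `μ` has a larger expected cost, strictly so if the dominance is strict. -/
lemma expected_cost_of_dominates {ι : Type*} (r : ι → ℕ) (S : Finset ι)
    (hinj : ∀ x ∈ S, ∀ y ∈ S, r x = r y → x = y) (μ ν cost : ι → ℝ)
    (hμ : ∀ x, 0 ≤ μ x) (hν : ∀ x, 0 ≤ ν x)
    (hμ_sum : ∑ x ∈ S, μ x = 1) (hν_sum : ∑ x ∈ S, ν x = 1) (hcost : ∀ x ∈ S, 0 ≤ cost x)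
    (hsupp : ∀ x ∈ S, 0 < μ x → ∀ y ∈ S, r x < r y → cost x < cost y)
    (hdom : ∀ z ∈ S, (∑ x ∈ S, if r z ≤ r x then μ x else 0) ≤
      ∑ x ∈ S, if r z ≤ r x then ν x else 0) :
    (∑ x ∈ S, μ x * cost x ≤ ∑ x ∈ S, ν x * cost x) ∧
      ((∃ z ∈ S, (∑ x ∈ S, if r z ≤ r x then μ x else 0) <
        ∑ x ∈ S, if r z ≤ r x then ν x else 0) →
      ∑ x ∈ S, μ x * cost x < ∑ x ∈ S, ν x * cost x) := by
  have hmin : ∀ z, ∃ y, z ∈ S → y ∈ S ∧ r z ≤ r y ∧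
      ∀ w ∈ S, r z ≤ r w → cost y ≤ cost w := by
    intro z
    by_cases hz : z ∈ S
    · obtain ⟨y, hy, hy'⟩ := exists_min_image (S.filter fun y => r z ≤ r y) cost
        ⟨z, by simp [hz]⟩
      rw [mem_filter] at hy
      exact ⟨y, fun _ => ⟨hy.1, hy.2, fun w hw hw' => hy' w (by simp [hw, hw'])⟩⟩
    · exact ⟨z, fun h => absurd h hz⟩
  choose g hg using hmin
  obtain ⟨d, hd, hfd⟩ := exists_increments r (fun z => cost (g z)) S hinj
    (fun x hx => hcost _ (hg x hx).1)
    (fun x hx y hy hxy => (hg x hx).2.2 _ (hg y hy).1 (hxy.trans (hg y hy).2.1))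
  have hg_supp : ∀ x ∈ S, 0 < μ x → g x = x := by
    intro x hx hpos
    by_contra hne
    have hlt : r x < r (g x) := lt_of_le_of_ne (hg x hx).2.1 fun h =>
      hne (hinj _ (hg x hx).1 _ hx h.symm)
    exact absurd ((hg x hx).2.2 x hx le_rfl) (not_le.2 (hsupp x hx hpos _ (hg x hx).1 hlt))
  have abel : ∀ ρ : ι → ℝ, ∑ x ∈ S, ρ x * cost (g x) =
      ∑ z ∈ S, d z * ∑ x ∈ S, if r z ≤ r x then ρ x else 0 := by
    intro ρ
    calc ∑ x ∈ S, ρ x * cost (g x)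
        = ∑ x ∈ S, ∑ z ∈ S, d z * if r z ≤ r x then ρ x else 0 := by
          refine sum_congr rfl fun x hx => ?_
          rw [hfd x hx, mul_sum]
          refine sum_congr rfl fun z _ => ?_
          split_ifs <;> ring
      _ = _ := by
          rw [sum_comm]
          exact sum_congr rfl fun z _ => (mul_sum _ _ _).symm
  have hμ_cost : ∑ x ∈ S, μ x * cost x = ∑ x ∈ S, μ x * cost (g x) := by
    refine sum_congr rfl fun x hx => ?_
    rcases (hμ x).eq_or_lt with h | h
    · simp [← h]
    · rw [hg_supp x hx h]
  have hν_cost : ∑ x ∈ S, ν x * cost (g x) ≤ ∑ x ∈ S, ν x * cost x :=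
    sum_le_sum fun x hx => mul_le_mul_of_nonneg_left ((hg x hx).2.2 x hx le_rfl) (hν x)
  rw [hμ_cost, abel μ]
  refine ⟨?_, ?_⟩
  · refine le_trans ?_ hν_cost
    rw [abel ν]
    exact sum_le_sum fun z hz => mul_le_mul_of_nonneg_left (hdom z hz) (hd z hz)
  rintro ⟨z₀, hz₀, hlt⟩
  refine lt_of_lt_of_le ?_ hν_cost
  rw [abel ν]
  have hne : (S.filter fun x => r x < r z₀ ∧ 0 < μ x).Nonempty := by
    by_contra hemp
    rw [not_nonempty_iff_eq_empty, filter_eq_empty_iff] at hemp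
    have h1 : (∑ x ∈ S, if r z₀ ≤ r x then μ x else 0) = 1 := by
      rw [← hμ_sum]
      refine sum_congr rfl fun x hx => ?_
      split_ifs with h
      · rfl
      · by_contra hx0
        exact hemp hx ⟨not_le.1 h, lt_of_le_of_ne (hμ x) hx0⟩
    have h2 : (∑ x ∈ S, if r z₀ ≤ r x then ν x else 0) ≤ 1 := by
      rw [← hν_sum]
      refine sum_le_sum fun x _ => ?_
      split_ifs
      exacts [le_rfl, hν x]
    linarith
  obtain ⟨x, hx, hxmax⟩ := exists_max_image _ r hne
  rw [mem_filter] at hx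
  obtain ⟨hx, hxz, hpos⟩ := hx
  obtain ⟨z, hz, hxz', hzz, hdz⟩ : ∃ z ∈ S, r x < r z ∧ r z ≤ r z₀ ∧ 0 < d z := by
    by_contra! hno
    have hle : cost (g z₀) ≤ cost (g x) := by
      rw [hfd z₀ hz₀, hfd x hx]
      refine sum_le_sum fun z hz => ?_
      split_ifs with h1 h2 h2
      · exact le_rfl
      · exact hno z hz (not_le.1 h2) h1
      · exact hd z hz
      · exact le_rfl
    rw [hg_supp x hx hpos] at hle
    exact absurd hle (not_le.2 (hsupp x hx hpos _ (hg z₀ hz₀).1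
      (hxz.trans_le (hg z₀ hz₀).2.1)))
  refine sum_lt_sum (fun w hw => mul_le_mul_of_nonneg_left (hdom w hw) (hd w hw)) ⟨z, hz, ?_⟩
  refine mul_lt_mul_of_pos_left ?_ hdz
  calc (∑ y ∈ S, if r z ≤ r y then μ y else 0)
      ≤ ∑ y ∈ S, if r z₀ ≤ r y then μ y else 0 := by
        refine sum_le_sum fun y hy => ?_
        split_ifs with h1 h2 h2
        · exact le_rfl
        · by_contra! hy0
          exact absurd (hxmax y (by simp [hy, hy0, not_le.1 h2])) (not_le.2 (hxz'.trans_le h1))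
        · exact hμ y
        · exact le_rfl
    _ < ∑ y ∈ S, if r z₀ ≤ r y then ν y else 0 := hlt
    _ ≤ ∑ y ∈ S, if r z ≤ r y then ν y else 0 := by
        refine sum_le_sum fun y _ => ?_
        split_ifs with h1 h2 h2
        · exact le_rfl
        · exact absurd (hzz.trans h1) h2
        · exact hν y
        · exact le_rfl

/-- **Ville's theorem of the alternative** for a finite family of vectors. -/
lemma ville_alternative {κ J : Type*} [Fintype κ] [Fintype J] (v : κ → J → ℝ) :
    (∃ p : J → ℝ, (∀ j, 0 ≤ p j) ∧ ∀ k, 0 < ∑ j, p j * v k j) ∨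
      ∃ α : κ → ℝ, (∀ k, 0 ≤ α k) ∧ ∑ k, α k = 1 ∧ ∀ j, ∑ k, α k * v k j ≤ 0 := by
  let L : (κ → ℝ) →ₗ[ℝ] (J → ℝ) := Fintype.linearCombination ℝ v
  have hL : ∀ α j, L α j = ∑ k, α k * v k j := fun α j => by
    simp [L, Fintype.linearCombination_apply]
  by_cases hdisj : Disjoint (L '' stdSimplex ℝ κ) (Set.Iic 0)
  · left
    obtain ⟨f, u, w, hfu, huw, hwf⟩ := geometric_hahn_banach_compact_closed
      ((convex_stdSimplex ℝ κ).linear_image L)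
      ((isCompact_stdSimplex ℝ κ).image (LinearMap.continuous_on_pi L))
      (convex_Iic 0) isClosed_Iic hdisj
    have hw0 : w < 0 := by simpa using hwf 0 (by simp)
    refine ⟨fun j => -f (Pi.single j 1), fun j => ?_, fun k => ?_⟩
    · by_contra! hneg
      have hpos : 0 < f (Pi.single j 1) := by linarith
      have h := hwf ((w / f (Pi.single j 1)) • Pi.single j 1) (by
        intro j'
        by_cases hj : j' = j
        · subst hj
          simpa using (div_neg_of_neg_of_pos hw0 hpos).le
        · simp [hj])
      rw [map_smul, smul_eq_mul, div_mul_cancel₀ _ hpos.ne'] at h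
      exact lt_irrefl _ h
    · have hk := hfu (v k) ⟨Pi.single k 1, single_mem_stdSimplex ℝ k, by
        ext j; simp [hL, Pi.single_apply]⟩
      have hv : f (v k) = ∑ j, v k j * f (Pi.single j 1) := by
        conv_lhs => rw [pi_eq_sum_univ' (v k)]
        rw [map_sum]
        refine sum_congr rfl fun j _ => ?_
        rw [map_smul, smul_eq_mul]
      have : ∑ j, -f (Pi.single j 1) * v k j = -f (v k) := by
        rw [hv, ← sum_neg_distrib]
        exact sum_congr rfl fun j _ => by ring
      rw [this]
      linarith
  · right
    obtain ⟨_, ⟨α, hα, rfl⟩, hle⟩ := Set.not_disjoint_iff.1 hdisj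
    exact ⟨α, hα.1, hα.2, fun j => by rw [← hL]; exact hle j⟩

/-- Pairing a reallocation of mass `α k` from `a k` to `b k` with a function `h`. -/
lemma sum_transfer_mul {ι κ : Type*} [DecidableEq ι] [Fintype κ] (S : Finset ι) (a b : κ → ι) (α : κ → ℝ)
    (hab : ∀ k, α k ≠ 0 → a k ∈ S ∧ b k ∈ S) (h : ι → ℝ) :
    ∑ z ∈ S, (∑ k, α k * ((if z = b k then 1 else 0) - if z = a k then 1 else 0)) * h z =
      ∑ k, α k * (h (b k) - h (a k)) := by
  simp_rw [sum_mul]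
  rw [sum_comm]
  refine sum_congr rfl fun k _ => ?_
  by_cases hk : α k = 0
  · simp [hk]
  · simp_rw [mul_assoc, ← mul_sum, sub_mul, sum_sub_distrib, ite_mul, one_mul, zero_mul]
    rw [sum_ite_eq' S (b k), sum_ite_eq' S (a k), if_pos (hab k hk).1, if_pos (hab k hk).2]

lemma upProb_eq_of_rank {m : ℕ} {S : Finset (Bundle m)} {pr : Bundle m → Bundle m → Prop}
    {r : Bundle m → ℕ} (hr : ∀ x ∈ S, ∀ y ∈ S, (pr x y ↔ r y < r x))
    (hinj : ∀ x ∈ S, ∀ y ∈ S, r x = r y → x = y) (μ : Bundle m → ℝ) {z : Bundle m} (hz : z ∈ S) :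
    upProb S pr μ z = ∑ x ∈ S, if r z ≤ r x then μ x else 0 := by
  refine sum_congr rfl fun x hx => ?_
  have : (x = z ∨ pr x z) ↔ r z ≤ r x := by
    rw [hr x hx z hz]
    constructor
    · rintro (rfl | h)
      exacts [le_rfl, h.le]
    · intro h
      rcases h.eq_or_lt with h | h
      exacts [Or.inl (hinj x hx z hz h.symm), Or.inr h]
  simp only [this]

lemma dotp_nonneg {m : ℕ} {p : Fin m → ℝ} (hp : ∀ j, 0 ≤ p j) (x : Bundle m) : 0 ≤ dotp p x :=
  sum_nonneg fun j _ => mul_nonneg (hp j) (Nat.cast_nonneg _)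

lemma sum_expected_dotp {n m : ℕ} (Ψ : Fin n → Finset (Bundle m)) (p : Fin m → ℝ)
    (μ : Fin n → Bundle m → ℝ) :
    ∑ i, ∑ x ∈ Ψ i, μ i x * dotp p x = ∑ j, p j * ∑ i, ∑ x ∈ Ψ i, μ i x * (x j : ℝ) := by
  simp_rw [dotp, mul_sum]
  rw [sum_comm (s := univ (α := Fin m))]
  refine sum_congr rfl fun i _ => ?_
  rw [sum_comm]
  exact sum_congr rfl fun j _ => sum_congr rfl fun x _ => by ring

/-- The price vector `p` supports the lottery allocation `xt` of the capacities `c`: only goods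
whose capacity is exhausted have a positive price, and every bundle preferred to one received with
positive probability is strictly more expensive. -/
structure Supports {n m : ℕ} (c : Fin m → ℕ) (Ψ : Fin n → Finset (Bundle m))
    (pref : Fin n → Bundle m → Bundle m → Prop) (xt : Fin n → Bundle m → ℝ)
    (p : Fin m → ℝ) : Prop where
  nonneg : ∀ j, 0 ≤ p j
  exhausted : ∀ j, 0 < p j → ∑ i, ∑ x ∈ Ψ i, xt i x * (x j : ℝ) = (c j : ℝ)
  lt_of_pref : ∀ i, ∀ x ∈ Ψ i, 0 < xt i x → ∀ y ∈ Ψ i, pref i y x → dotp p x < dotp p y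

section

variable {n m : ℕ} {c : Fin m → ℕ} {Ψ : Fin n → Finset (Bundle m)}
  {pref : Fin n → Bundle m → Bundle m → Prop} {xt : Fin n → Bundle m → ℝ} {p : Fin m → ℝ}

lemma Supports.not_dominated (hs : Supports c Ψ pref xt p)
    (hirr : ∀ i, ∀ x ∈ Ψ i, ¬ pref i x x)
    (htrans : ∀ i, ∀ x ∈ Ψ i, ∀ y ∈ Ψ i, ∀ z ∈ Ψ i,
        pref i x y → pref i y z → pref i x z)
    (htotal : ∀ i, ∀ x ∈ Ψ i, ∀ y ∈ Ψ i, x ≠ y → pref i x y ∨ pref i y x)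
    (hx_nonneg : ∀ i x, 0 ≤ xt i x) (hx_sum : ∀ i, ∑ x ∈ Ψ i, xt i x = 1)
    {yt : Fin n → Bundle m → ℝ} (hy_nonneg : ∀ i x, 0 ≤ yt i x)
    (hy_sum : ∀ i, ∑ x ∈ Ψ i, yt i x = 1)
    (hy_feas : ∀ j, ∑ i, ∑ x ∈ Ψ i, yt i x * (x j : ℝ) ≤ (c j : ℝ))
    (hdom : ∀ i, ∀ z ∈ Ψ i, upProb (Ψ i) (pref i) (xt i) z ≤ upProb (Ψ i) (pref i) (yt i) z) :
    ¬ ∃ i, ∃ z ∈ Ψ i, upProb (Ψ i) (pref i) (xt i) z < upProb (Ψ i) (pref i) (yt i) z := by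
  rintro ⟨i₀, z₀, hz₀, hlt⟩
  choose r hr hinj using fun i => exists_rank (Ψ i) (pref i) (hirr i) (htrans i) (htotal i)
  have key := fun i => expected_cost_of_dominates (r i) (Ψ i) (hinj i) (xt i) (yt i) (dotp p)
    (hx_nonneg i) (hy_nonneg i) (hx_sum i) (hy_sum i) (fun x _ => dotp_nonneg hs.nonneg x)
    (fun x hx hpos y hy hxy => hs.lt_of_pref i x hx hpos y hy ((hr i y hy x hx).2 hxy))
    (fun z hz => by
      rw [← upProb_eq_of_rank (hr i) (hinj i) _ hz, ← upProb_eq_of_rank (hr i) (hinj i) _ hz]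
      exact hdom i z hz)
  have hsum : ∑ i, ∑ x ∈ Ψ i, xt i x * dotp p x < ∑ i, ∑ x ∈ Ψ i, yt i x * dotp p x := by
    refine sum_lt_sum (fun i _ => (key i).1) ⟨i₀, mem_univ _, (key i₀).2 ⟨z₀, hz₀, ?_⟩⟩
    rwa [← upProb_eq_of_rank (hr i₀) (hinj i₀) _ hz₀,
      ← upProb_eq_of_rank (hr i₀) (hinj i₀) _ hz₀]
  rw [sum_expected_dotp, sum_expected_dotp] at hsum
  refine absurd hsum (not_lt.2 (sum_le_sum fun j _ => ?_))
  rcases (hs.nonneg j).eq_or_lt with h | h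
  · simp [← h]
  · rw [hs.exhausted j h]
    exact mul_le_mul_of_nonneg_left (hy_feas j) h.le

lemma exists_supports_of_efficient
    (hirr : ∀ i, ∀ x ∈ Ψ i, ¬ pref i x x)
    (htrans : ∀ i, ∀ x ∈ Ψ i, ∀ y ∈ Ψ i, ∀ z ∈ Ψ i,
        pref i x y → pref i y z → pref i x z)
    (hx_nonneg : ∀ i x, 0 ≤ xt i x) (hx_supp : ∀ i x, x ∉ Ψ i → xt i x = 0)
    (hx_sum : ∀ i, ∑ x ∈ Ψ i, xt i x = 1)
    (hx_feas : ∀ j, ∑ i, ∑ x ∈ Ψ i, xt i x * (x j : ℝ) ≤ (c j : ℝ))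
    (heff : ¬ ∃ yt : Fin n → Bundle m → ℝ,
        (∀ i x, 0 ≤ yt i x) ∧ (∀ i x, x ∉ Ψ i → yt i x = 0) ∧
        (∀ i, ∑ x ∈ Ψ i, yt i x = 1) ∧
        (∀ j, ∑ i, ∑ x ∈ Ψ i, yt i x * (x j : ℝ) ≤ (c j : ℝ)) ∧
        (∀ i, ∀ z ∈ Ψ i, upProb (Ψ i) (pref i) (xt i) z ≤ upProb (Ψ i) (pref i) (yt i) z) ∧
        (∃ i, ∃ z ∈ Ψ i, upProb (Ψ i) (pref i) (xt i) z < upProb (Ψ i) (pref i) (yt i) z)) :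
    ∃ p, Supports c Ψ pref xt p := by
  let E : Fin m → ℝ := fun j => ∑ i, ∑ x ∈ Ψ i, xt i x * (x j : ℝ)
  let κ := (univ : Finset (Fin n)).sigma fun i =>
    (Ψ i ×ˢ Ψ i).filter fun q => 0 < xt i q.1 ∧ pref i q.2 q.1
  have hκ : ∀ k : κ, (k.1.2.1 ∈ Ψ k.1.1 ∧ k.1.2.2 ∈ Ψ k.1.1) ∧
      0 < xt k.1.1 k.1.2.1 ∧ pref k.1.1 k.1.2.2 k.1.2.1 := fun k => by
    have h := k.2
    simpa only [κ, mem_sigma, mem_univ, true_and, mem_filter, mem_product] using h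
  rcases ville_alternative fun (k : κ) j =>
    if E j = c j then (k.1.2.2 j : ℝ) - k.1.2.1 j else 0 with ⟨p, hp, hpos⟩ | ⟨α, hα, hα_sum, hle⟩
  · refine ⟨fun j => if E j = c j then p j else 0, fun j => ?_, fun j hj => ?_,
      fun i x hx hxpos y hy hyx => ?_⟩
    · split_ifs
      exacts [hp j, le_rfl]
    · by_contra hne
      exact hj.ne' (if_neg hne)
    · have h := hpos ⟨⟨i, x, y⟩, by simp [κ, hx, hy, hxpos, hyx]⟩
      rw [← sub_pos, dotp, dotp, ← sum_sub_distrib]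
      refine h.trans_eq (sum_congr rfl fun j _ => ?_)
      split_ifs <;> ring
  exfalso
  let β : Fin n → κ → ℝ := fun i k => if k.1.1 = i then α k else 0
  let g : Fin n → Bundle m → ℝ := fun i z =>
    ∑ k, β i k * ((if z = k.1.2.2 then 1 else 0) - if z = k.1.2.1 then 1 else 0)
  have hβ : ∀ i k, β i k ≠ 0 → k.1.1 = i := fun i k h => by
    by_contra hne
    exact h (if_neg hne)
  have hβ0 : ∀ i k, 0 ≤ β i k := fun i k => by
    dsimp only [β]
    split_ifs
    exacts [hα k, le_rfl]
  have hg : ∀ i (h : Bundle m → ℝ),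
      ∑ z ∈ Ψ i, g i z * h z = ∑ k, β i k * (h k.1.2.2 - h k.1.2.1) := fun i h =>
    sum_transfer_mul (Ψ i) (fun k : κ => k.1.2.1) (fun k : κ => k.1.2.2) (β i)
      (fun k hk => hβ i k hk ▸ (hκ k).1) h
  have hg_supp : ∀ i z, z ∉ Ψ i → g i z = 0 := by
    intro i z hz
    refine sum_eq_zero fun k _ => ?_
    by_cases hk : β i k = 0
    · simp [hk]
    · obtain ⟨h1, h2⟩ := hβ i k hk ▸ (hκ k).1
      rw [if_neg fun h : z = _ => hz (h ▸ h2), if_neg fun h : z = _ => hz (h ▸ h1)]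
      simp
  have hg_nonneg : ∀ i z, xt i z = 0 → 0 ≤ g i z := by
    intro i z hz
    refine sum_nonneg fun k _ => ?_
    by_cases hk : β i k = 0
    · simp [hk]
    · have h1 : 0 < xt i k.1.2.1 := hβ i k hk ▸ (hκ k).2.1
      rw [if_neg fun h : z = k.1.2.1 => h1.ne' (by rw [← h, hz]), sub_zero]
      refine mul_nonneg (hβ0 i k) ?_
      split_ifs <;> norm_num
  let G : Fin m → ℝ := fun j => ∑ i, ∑ z ∈ Ψ i, g i z * (z j : ℝ)
  have hG : ∀ j, G j = ∑ k : κ, α k * ((k.1.2.2 j : ℝ) - k.1.2.1 j) := by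
    intro j
    simp only [G]
    rw [sum_congr rfl fun i _ => hg i fun z => (z j : ℝ), sum_comm]
    refine sum_congr rfl fun k _ => ?_
    simp [β]
  have hsmall : ∀ a b : ℝ, 0 < a → ∀ᶠ ε in nhdsWithin (0 : ℝ) (Set.Ioi 0), 0 ≤ a + ε * b := by
    intro a b ha
    have : Filter.Tendsto (fun ε : ℝ => a + ε * b) (nhds 0) (nhds (a + 0 * b)) :=
      Continuous.tendsto (by fun_prop) 0
    filter_upwards [(this.mono_left nhdsWithin_le_nhds).eventually
      (lt_mem_nhds (by simpa using ha : 0 < a + 0 * b))] with ε h using h.le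
  have hev1 : ∀ᶠ ε in nhdsWithin (0 : ℝ) (Set.Ioi 0),
      ∀ i, ∀ z ∈ Ψ i, 0 ≤ xt i z + ε * g i z := by
    refine Filter.eventually_all.2 fun i => (Filter.eventually_all_finset _).2 fun z _ => ?_
    rcases (hx_nonneg i z).eq_or_lt with h | h
    · filter_upwards [self_mem_nhdsWithin] with ε hε
      rw [← h, zero_add]
      exact mul_nonneg (le_of_lt hε) (hg_nonneg i z h.symm)
    · exact hsmall _ _ h
  have hev2 : ∀ᶠ ε in nhdsWithin (0 : ℝ) (Set.Ioi 0), ∀ j, E j + ε * G j ≤ c j := by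
    refine Filter.eventually_all.2 fun j => ?_
    rcases (hx_feas j).eq_or_lt with h | h
    · filter_upwards [self_mem_nhdsWithin] with ε hε
      have hGj : G j ≤ 0 := by
        have h' : E j = c j := h
        simpa [hG, h'] using hle j
      have := mul_nonpos_of_nonneg_of_nonpos (le_of_lt hε) hGj
      change E j = c j at h
      linarith
    · filter_upwards [hsmall (c j - E j) (-G j) (sub_pos.2 h)] with ε hε
      linarith
  obtain ⟨ε, ⟨h1, h2⟩, hε⟩ := ((hev1.and hev2).and self_mem_nhdsWithin).exists
  have hε : 0 < ε := hε
  have hsum : ∀ i (h : Bundle m → ℝ), ∑ z ∈ Ψ i, (xt i z + ε * g i z) * h z =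
      ∑ z ∈ Ψ i, xt i z * h z + ε * ∑ k, β i k * (h k.1.2.2 - h k.1.2.1) := fun i h => by
    rw [← hg, mul_sum, ← sum_add_distrib]
    exact sum_congr rfl fun z _ => by ring
  let I : Fin n → Bundle m → Bundle m → ℝ := fun i z x => if x = z ∨ pref i x z then 1 else 0
  have hup : ∀ i z (μ : Bundle m → ℝ), upProb (Ψ i) (pref i) μ z = ∑ x ∈ Ψ i, μ x * I i z x :=
    fun i z μ => by simp [upProb, I]
  have hI : ∀ i, ∀ z ∈ Ψ i, ∀ k, 0 ≤ β i k * (I i z k.1.2.2 - I i z k.1.2.1) := by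
    intro i z hz k
    by_cases hk : β i k = 0
    · simp [hk]
    · refine mul_nonneg (hβ0 i k) (sub_nonneg.2 ?_)
      obtain ⟨⟨hx, hy⟩, -, hyx⟩ := hβ i k hk ▸ hκ k
      simp only [I]
      split_ifs with ha hb hb
      · exact le_rfl
      · refine absurd (Or.inr ?_) hb
        rcases ha with ha | ha
        · rwa [← ha]
        · exact htrans i _ hy _ hx _ hz hyx ha
      · exact zero_le_one
      · exact le_rfl
  refine heff ⟨fun i z => xt i z + ε * g i z, fun i z => ?_, fun i z hz => ?_, fun i => ?_,
    fun j => ?_, fun i z hz => ?_, ?_⟩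
  · by_cases hz : z ∈ Ψ i
    · exact h1 i z hz
    · simp [hx_supp i z hz, hg_supp i z hz]
  · simp [hx_supp i z hz, hg_supp i z hz]
  · simpa [hx_sum i] using hsum i fun _ => 1
  · refine le_trans (le_of_eq ?_) (h2 j)
    simp only [E, G, mul_sum]
    rw [← sum_add_distrib]
    refine sum_congr rfl fun i _ => ?_
    rw [← sum_add_distrib]
    exact sum_congr rfl fun z _ => by ring
  · rw [hup, hup, hsum i (I i z)]
    exact le_add_of_nonneg_right (mul_nonneg hε.le (sum_nonneg fun k _ => hI i z hz k))
  · obtain ⟨k, -, hk⟩ : ∃ k ∈ univ, 0 < α k := by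
      by_contra! hno
      linarith [sum_nonpos hno]
    obtain ⟨⟨hx, hy⟩, -, hyx⟩ := hκ k
    refine ⟨k.1.1, k.1.2.2, hy, ?_⟩
    rw [hup, hup, hsum k.1.1 (I k.1.1 k.1.2.2)]
    refine lt_add_of_pos_right _ (mul_pos hε (sum_pos' (fun k' _ => hI _ _ hy k')
      ⟨k, mem_univ _, ?_⟩))
    have hnot : ¬ (k.1.2.1 = k.1.2.2 ∨ pref k.1.1 k.1.2.1 k.1.2.2) := by
      rintro (h | h)
      · exact hirr _ _ hy (by rwa [h] at hyx)
      · exact hirr _ _ hx (htrans _ _ hx _ hy _ hx h hyx)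
    simpa [β, I, hnot] using hk

lemma supports_of_ceri {D : Fin n → (Fin m → ℝ) → ℝ → Bundle m}
    (hirr : ∀ i, ∀ x ∈ Ψ i, ¬ pref i x x)
    (htrans : ∀ i, ∀ x ∈ Ψ i, ∀ y ∈ Ψ i, ∀ z ∈ Ψ i,
        pref i x y → pref i y z → pref i x z)
    (hD : ∀ (i : Fin n) (p : Fin m → ℝ) (b : ℝ), (∀ j, 0 ≤ p j) → 0 ≤ b →
        D i p b ∈ Ψ i ∧ dotp p (D i p b) ≤ b ∧
        ∀ x ∈ Ψ i, dotp p x ≤ b → x = D i p b ∨ pref i (D i p b) x)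
    {B : Fin n → Measure ℝ} (hB : ∀ i, B i {b | b < 0} = 0) (hp : ∀ j, 0 ≤ p j)
    (hclear : ∀ j, 0 < p j →
      ∑ i, ∑ x ∈ Ψ i, (B i {b | D i p b = x}).toReal * (x j : ℝ) = (c j : ℝ))
    (hxt : ∀ i, ∀ x ∈ Ψ i, xt i x = (B i {b | D i p b = x}).toReal) :
    Supports c Ψ pref xt p := by
  refine ⟨hp, fun j hj => ?_, fun i x hx hpos y hy hyx => ?_⟩
  · rw [← hclear j hj]
    exact sum_congr rfl fun i _ => sum_congr rfl fun x hx => by rw [hxt i x hx]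
  · obtain ⟨b, hb, hb0⟩ : ∃ b, D i p b = x ∧ 0 ≤ b := by
      by_contra! hno
      have : B i {b | D i p b = x} = 0 := measure_mono_null (fun b hb => hno b hb) (hB i)
      rw [hxt i x hx, this] at hpos
      exact lt_irrefl _ hpos
    obtain ⟨-, hle, hbest⟩ := hD i p b hp hb0
    rw [hb] at hle hbest
    refine hle.trans_lt (not_le.1 fun hyb => ?_)
    rcases hbest y hy hyb with rfl | h
    · exact hirr i y hy hyx
    · exact hirr i x hx (htrans i x hx y hy x hx h hyx)

lemma Supports.exists_ceri (hs : Supports c Ψ pref xt p)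
    {D : Fin n → (Fin m → ℝ) → ℝ → Bundle m}
    (hD : ∀ (i : Fin n) (p : Fin m → ℝ) (b : ℝ), (∀ j, 0 ≤ p j) → 0 ≤ b →
        D i p b ∈ Ψ i ∧ dotp p (D i p b) ≤ b ∧
        ∀ x ∈ Ψ i, dotp p x ≤ b → x = D i p b ∨ pref i (D i p b) x)
    (hx_nonneg : ∀ i x, 0 ≤ xt i x) (hx_sum : ∀ i, ∑ x ∈ Ψ i, xt i x = 1) :
    ∃ B : Fin n → Measure ℝ, (∀ i, IsProbabilityMeasure (B i)) ∧ (∀ i, B i {b | b < 0} = 0) ∧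
      ∀ i, ∀ x ∈ Ψ i, xt i x = (B i {b | D i p b = x}).toReal := by
  let B : Fin n → Measure ℝ := fun i =>
    ∑ x ∈ Ψ i, ENNReal.ofReal (xt i x) • Measure.dirac (dotp p x)
  have hB : ∀ i (s : Set ℝ),
      B i s = ∑ x ∈ Ψ i, ENNReal.ofReal (xt i x) * s.indicator 1 (dotp p x) := fun i s => by
    simp [B, Measure.finsetSum_apply]
  refine ⟨B, fun i => ⟨?_⟩, fun i => ?_, fun i x hx => ?_⟩
  · rw [hB]
    simp only [Set.indicator_univ, Pi.one_apply, mul_one]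
    rw [← ENNReal.ofReal_sum_of_nonneg fun x _ => hx_nonneg i x, hx_sum, ENNReal.ofReal_one]
  · rw [hB]
    refine sum_eq_zero fun x _ => ?_
    have : dotp p x ∉ {b : ℝ | b < 0} := not_lt.2 (dotp_nonneg hs.nonneg x)
    rw [Set.indicator_of_notMem this, mul_zero]
  · have hdemand : ∀ y ∈ Ψ i, 0 < xt i y → D i p (dotp p y) = y := by
      intro y hy hpos
      obtain ⟨hmem, hle, hbest⟩ := hD i p (dotp p y) hs.nonneg (dotp_nonneg hs.nonneg y)
      rcases hbest y hy le_rfl with h | h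
      · exact h.symm
      · exact absurd hle (not_le.2 (hs.lt_of_pref i y hy hpos _ hmem h))
    rw [hB, sum_eq_single x]
    · rcases (hx_nonneg i x).eq_or_lt with h | h
      · simp [← h]
      · simp [hdemand x hx h, h.le]
    · intro y hy hyx
      rcases (hx_nonneg i y).eq_or_lt with h | h
      · simp [← h]
      · simp [hdemand y hy h, hyx]
    · exact fun h => absurd hx h

end

/-- **Characterization of ordinal efficiency** (Theorem 3, Welfare Theorems): a feasible
lottery allocation is ordinally efficient if and only if it is a CERI allocation, i.e.
there are budget distributions and a price vector forming a CERI whose random demands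
are exactly the given lotteries. -/
theorem ordinally_efficient_iff_ceri
    (n m Δ : ℕ) (hΔ : 0 < Δ)
    (c : Fin m → ℕ)
    (Ψ : Fin n → Finset (Bundle m))
    (hzero : ∀ i, (0 : Bundle m) ∈ Ψ i)
    (hsize : ∀ i, ∀ x ∈ Ψ i, ∑ j, x j ≤ Δ)
    (pref : Fin n → Bundle m → Bundle m → Prop)
    (hirr : ∀ i, ∀ x ∈ Ψ i, ¬ pref i x x)
    (htrans : ∀ i, ∀ x ∈ Ψ i, ∀ y ∈ Ψ i, ∀ z ∈ Ψ i,
        pref i x y → pref i y z → pref i x z)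
    (htotal : ∀ i, ∀ x ∈ Ψ i, ∀ y ∈ Ψ i, x ≠ y → pref i x y ∨ pref i y x)
    (hleast : ∀ i, ∀ x ∈ Ψ i, x ≠ 0 → pref i x 0)
    (D : Fin n → (Fin m → ℝ) → ℝ → Bundle m)
    (hD : ∀ (i : Fin n) (p : Fin m → ℝ) (b : ℝ), (∀ j, 0 ≤ p j) → 0 ≤ b →
        D i p b ∈ Ψ i ∧ dotp p (D i p b) ≤ b ∧
        ∀ x ∈ Ψ i, dotp p x ≤ b → x = D i p b ∨ pref i (D i p b) x)
    -- a feasible lottery allocation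
    (xt : Fin n → Bundle m → ℝ)
    (hx_nonneg : ∀ i x, 0 ≤ xt i x)
    (hx_supp : ∀ i x, x ∉ Ψ i → xt i x = 0)
    (hx_sum : ∀ i, ∑ x ∈ Ψ i, xt i x = 1)
    (hx_feas : ∀ j, ∑ i, ∑ x ∈ Ψ i, xt i x * (x j : ℝ) ≤ (c j : ℝ)) :
    -- ordinal efficiency ...
    ((¬ ∃ yt : Fin n → Bundle m → ℝ,
        (∀ i x, 0 ≤ yt i x) ∧ (∀ i x, x ∉ Ψ i → yt i x = 0) ∧
        (∀ i, ∑ x ∈ Ψ i, yt i x = 1) ∧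
        (∀ j, ∑ i, ∑ x ∈ Ψ i, yt i x * (x j : ℝ) ≤ (c j : ℝ)) ∧
        (∀ i, ∀ z ∈ Ψ i, upProb (Ψ i) (pref i) (xt i) z ≤ upProb (Ψ i) (pref i) (yt i) z) ∧
        (∃ i, ∃ z ∈ Ψ i, upProb (Ψ i) (pref i) (xt i) z < upProb (Ψ i) (pref i) (yt i) z))
      ↔
    -- ... iff it is a CERI allocation
      (∃ (B : Fin n → Measure ℝ) (p : Fin m → ℝ),
        (∀ i, IsProbabilityMeasure (B i)) ∧
        (∀ i, B i {b | b < 0} = 0) ∧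
        (∀ j, 0 ≤ p j) ∧
        (∀ j, ∑ i, ∑ x ∈ Ψ i, (B i {b | D i p b = x}).toReal * (x j : ℝ) ≤ (c j : ℝ)) ∧
        (∀ j, 0 < p j →
          ∑ i, ∑ x ∈ Ψ i, (B i {b | D i p b = x}).toReal * (x j : ℝ) = (c j : ℝ)) ∧
        (∀ i, ∀ x ∈ Ψ i, xt i x = (B i {b | D i p b = x}).toReal))) := by
  constructor
  · intro heff
    obtain ⟨p, hs⟩ := exists_supports_of_efficient hirr htrans hx_nonneg hx_supp hx_sum hx_feas heff
    obtain ⟨B, hB, hB0, hxt⟩ := hs.exists_ceri hD hx_nonneg hx_sum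
    have hE : ∀ j, ∑ i, ∑ x ∈ Ψ i, (B i {b | D i p b = x}).toReal * (x j : ℝ) =
        ∑ i, ∑ x ∈ Ψ i, xt i x * (x j : ℝ) := fun j =>
      sum_congr rfl fun i _ => sum_congr rfl fun x hx => by rw [hxt i x hx]
    exact ⟨B, p, hB, hB0, hs.nonneg, fun j => (hE j).trans_le (hx_feas j),
      fun j hj => (hE j).trans (hs.exhausted j hj), hxt⟩
  · rintro ⟨B, p, -, hB0, hp, -, hclear, hxt⟩ ⟨yt, hy_nonneg, -, hy_sum, hy_feas, hdom, hstrict⟩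
    exact (supports_of_ceri hirr htrans hD hB0 hp hclear hxt).not_dominated hirr htrans htotal
      hx_nonneg hx_sum hy_nonneg hy_sum hy_feas hdom hstrict
end
end

section
/- Let (p, (B_1,…,B_n)) be a CERI and let (b_1,…,b_n) be any budgets with b_i ≥ 0 such that Σ_{i=1}^n D_i(p, b_i) ≤ c + (Δ−1)·1 coordinatewise. Then the deterministic allocation (D_1(p,b_1),…,D_n(p,b_n)) is (Δ−1)-ex-post efficient. Consequently, every allocation in the support of a (Δ−1)-near-feasible ex-post implementation of a CERI is (Δ−1)-ex-post efficient. -/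
open MeasureTheory Finset

noncomputable section

/-- The total price of a profile of bundles is the price of the aggregate bundle. -/
theorem sum_dotp {m : ℕ} {ι : Type*} [Fintype ι] (p : Fin m → ℝ) (x : ι → Bundle m) :
    ∑ i, dotp p (x i) = dotp p (fun j => ∑ i, x i j) := by
  simp only [dotp, Nat.cast_sum, Finset.mul_sum]
  exact Finset.sum_comm

/-- At nonnegative prices, larger bundles cost more. -/
theorem dotp_mono {m : ℕ} {p : Fin m → ℝ} (hp : ∀ j, 0 ≤ p j) {x y : Bundle m}
    (hxy : ∀ j, x j ≤ y j) : dotp p x ≤ dotp p y :=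
  Finset.sum_le_sum fun j _ => mul_le_mul_of_nonneg_left (Nat.cast_le.mpr (hxy j)) (hp j)

/-- **Ex-post efficiency** (Theorem 4): any deterministic allocation of demanded bundles at
the CERI price vector with realized budgets, that exceeds capacity by at most `Δ - 1` units
of each good, is `(Δ-1)`-ex-post efficient: Pareto efficient with respect to some capacity
vector `c' ≤ c + (Δ-1)·1`. -/
theorem ceri_expost_efficient
    (n m Δ : ℕ) (hΔ : 0 < Δ)
    (c : Fin m → ℕ)
    (Ψ : Fin n → Finset (Bundle m))
    (hzero : ∀ i, (0 : Bundle m) ∈ Ψ i)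
    (hsize : ∀ i, ∀ x ∈ Ψ i, ∑ j, x j ≤ Δ)
    (pref : Fin n → Bundle m → Bundle m → Prop)
    (hirr : ∀ i, ∀ x ∈ Ψ i, ¬ pref i x x)
    (htrans : ∀ i, ∀ x ∈ Ψ i, ∀ y ∈ Ψ i, ∀ z ∈ Ψ i,
        pref i x y → pref i y z → pref i x z)
    (htotal : ∀ i, ∀ x ∈ Ψ i, ∀ y ∈ Ψ i, x ≠ y → pref i x y ∨ pref i y x)
    (hleast : ∀ i, ∀ x ∈ Ψ i, x ≠ 0 → pref i x 0)
    (D : Fin n → (Fin m → ℝ) → ℝ → Bundle m)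
    (hD : ∀ (i : Fin n) (p : Fin m → ℝ) (b : ℝ), (∀ j, 0 ≤ p j) → 0 ≤ b →
        D i p b ∈ Ψ i ∧ dotp p (D i p b) ≤ b ∧
        ∀ x ∈ Ψ i, dotp p x ≤ b → x = D i p b ∨ pref i (D i p b) x)
    (B : Fin n → Measure ℝ)
    (hBprob : ∀ i, IsProbabilityMeasure (B i))
    (hBnonneg : ∀ i, B i {b | b < 0} = 0)
    -- the CERI conditions for price vector `p`
    (p : Fin m → ℝ) (hp : ∀ j, 0 ≤ p j)
    (hmarket_le : ∀ j,
        ∑ i, ∑ x ∈ Ψ i, (B i {b | D i p b = x}).toReal * (x j : ℝ) ≤ (c j : ℝ))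
    (hmarket_eq : ∀ j, 0 < p j →
        ∑ i, ∑ x ∈ Ψ i, (B i {b | D i p b = x}).toReal * (x j : ℝ) = (c j : ℝ))
    -- realized budgets giving a (Δ-1)-near-feasible allocation of demanded bundles
    (bud : Fin n → ℝ) (hbud : ∀ i, 0 ≤ bud i)
    (hnear : ∀ j, ∑ i, D i p (bud i) j ≤ c j + (Δ - 1)) :
    ∃ c' : Fin m → ℕ, (∀ j, c' j ≤ c j + (Δ - 1)) ∧
      ¬ ∃ y : Fin n → Bundle m,
        (∀ i, y i ∈ Ψ i) ∧
        (∀ j, ∑ i, y i j ≤ c' j) ∧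
        (∀ i, y i = D i p (bud i) ∨ pref i (y i) (D i p (bud i))) ∧
        (∃ i, pref i (y i) (D i p (bud i))) := by
  refine ⟨fun j => ∑ i, D i p (bud i) j, hnear, ?_⟩
  rintro ⟨y, hyΨ, hycap, hyweak, i₀, hi₀⟩
  have hstrict : ∀ i, pref i (y i) (D i p (bud i)) → dotp p (D i p (bud i)) < dotp p (y i) := by
    intro i hi
    obtain ⟨hmem, hafford, hbest⟩ := hD i p (bud i) hp (hbud i)
    by_contra! hle
    rcases hbest (y i) (hyΨ i) (hle.trans hafford) with heq | hpref
    · exact hirr i _ hmem (heq ▸ hi)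
    · exact hirr i _ hmem (htrans i _ hmem _ (hyΨ i) _ hmem hpref hi)
  have hlt : ∑ i, dotp p (D i p (bud i)) < ∑ i, dotp p (y i) := by
    refine Finset.sum_lt_sum (fun i _ => ?_) ⟨i₀, Finset.mem_univ _, hstrict i₀ hi₀⟩
    rcases hyweak i with heq | hpref
    · rw [heq]
    · exact (hstrict i hpref).le
  rw [sum_dotp, sum_dotp] at hlt
  exact absurd hlt (not_lt.mpr (dotp_mono hp hycap))
end
end

section
/- Suppose all agents share the same finite set Ψ of acceptable bundles (with possibly different strict linear orders ≻_i on Ψ) and the same budget distribution B (a Borel probability measure on [0,∞)). Let p ∈ ℝ^m with p ≥ 0 be any price vector. Then the profile of random demands at p is ordinally envy-free: for every pair of agents i, i′ and every z ∈ Ψ, B({b : D_i(p,b) ⪰_i z}) ≥ B({b : D_{i′}(p,b) ⪰_i z}); that is, agent i's random demand stochastically dominates agent i′'s random demand with respect to ≻_i. In particular, the allocation of any CERI in which all budget distributions are identical is ordinally envy-free. -/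
open MeasureTheory Finset

noncomputable section

/-- **Ordinal envy-freeness with identical budget distributions** (Theorem 5(i)): if all
agents have the same acceptable set `Ψ` and the same budget distribution `B`, then for any
price vector `p ≥ 0` and any two agents `i, i'`, agent `i`'s random demand first-order
stochastically dominates agent `i'`'s random demand with respect to `≻ᵢ`. In particular,
the allocation of any CERI with identical budget distributions is ordinally envy-free. -/
theorem ceri_ordinally_envy_free
    (n m Δ : ℕ) (hΔ : 0 < Δ)
    (Ψ : Finset (Bundle m))
    (hzero : (0 : Bundle m) ∈ Ψ)
    (hsize : ∀ x ∈ Ψ, ∑ j, x j ≤ Δ)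
    (pref : Fin n → Bundle m → Bundle m → Prop)
    (hirr : ∀ i, ∀ x ∈ Ψ, ¬ pref i x x)
    (htrans : ∀ i, ∀ x ∈ Ψ, ∀ y ∈ Ψ, ∀ z ∈ Ψ,
        pref i x y → pref i y z → pref i x z)
    (htotal : ∀ i, ∀ x ∈ Ψ, ∀ y ∈ Ψ, x ≠ y → pref i x y ∨ pref i y x)
    (hleast : ∀ i, ∀ x ∈ Ψ, x ≠ 0 → pref i x 0)
    (D : Fin n → (Fin m → ℝ) → ℝ → Bundle m)
    (hD : ∀ (i : Fin n) (p : Fin m → ℝ) (b : ℝ), (∀ j, 0 ≤ p j) → 0 ≤ b →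
        D i p b ∈ Ψ ∧ dotp p (D i p b) ≤ b ∧
        ∀ x ∈ Ψ, dotp p x ≤ b → x = D i p b ∨ pref i (D i p b) x)
    -- a common budget distribution
    (B : Measure ℝ)
    (hBprob : IsProbabilityMeasure B)
    (hBnonneg : B {b | b < 0} = 0)
    (p : Fin m → ℝ) (hp : ∀ j, 0 ≤ p j)
    (i i' : Fin n) (z : Bundle m) (hz : z ∈ Ψ) :
    B {b | D i' p b = z ∨ pref i (D i' p b) z} ≤
      B {b | D i p b = z ∨ pref i (D i p b) z} := by
  refine measure_mono_ae ?_
  have hb_nonneg : ∀ᵐ b ∂B, 0 ≤ b := by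
    simpa only [ae_iff, not_le] using hBnonneg
  filter_upwards [hb_nonneg] with b hb hz'
  obtain ⟨hmem, -, hbest⟩ := hD i p b hp hb
  obtain ⟨hmem', hafford', -⟩ := hD i' p b hp hb
  change D i p b = z ∨ pref i (D i p b) z
  change D i' p b = z ∨ pref i (D i' p b) z at hz'
  rcases hbest _ hmem' hafford' with heq | hpref
  · rwa [← heq]
  · rcases hz' with rfl | hz'
    · exact Or.inr hpref
    · exact Or.inr (htrans i _ hmem _ hmem' _ hz hpref hz')
end
end

section
/- Suppose Δ ≥ 2, all agents share the same finite acceptable set Ψ ⊆ ℕ^m (with possibly different strict linear orders), and Ψ is downward closed (if x ∈ Ψ and 0 ≤ y ≤ x coordinatewise then y ∈ Ψ). Let b > 0, let p ∈ ℝ^m with p ≥ 0 be any price vector, and let i, i′ be any two agents with budgets b_i, b_{i′} ∈ [b, (Δ/(Δ−1))·b]. Set x_i = D_i(p, b_i) and x_{i′} = D_{i′}(p, b_{i′}). Then there exists a good j such that x_i ⪰_i (x_{i′} − e^j)^+, where (x − e^j)^+ denotes x with one unit of good j removed if x_j ≥ 1 and x itself otherwise. Consequently, if all budget distributions are supported within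 [b, (Δ/(Δ−1))·b], then every allocation in the support of any ex-post implementation of a CERI is envy-free up to one good (EF1). -/
open Finset

noncomputable section

/-- The bundle `x` with one unit of good `j` removed (i.e. `(x - e^j)⁺`); if `x j = 0`
truncated subtraction leaves `x` unchanged. -/
def removeOne {m : ℕ} (x : Bundle m) (j : Fin m) : Bundle m :=
  fun k => if k = j then x j - 1 else x k

theorem dotp_removeOne {m : ℕ} (p : Fin m → ℝ) (x : Bundle m) (j : Fin m) (hj : x j ≠ 0) :
    dotp p (removeOne x j) = dotp p x - p j := by
  have h : ∀ k, p k * (removeOne x j k : ℝ) = p k * (x k : ℝ) - if k = j then p j else 0 := by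
    intro k
    by_cases hk : k = j
    · subst hk
      simp [removeOne, Nat.cast_sub (Nat.one_le_iff_ne_zero.mpr hj), mul_sub]
    · simp [removeOne, hk]
  simp [dotp, h]

theorem removeOne_le {m : ℕ} (x : Bundle m) (j k : Fin m) : removeOne x j k ≤ x k := by
  unfold removeOne
  split_ifs with hk
  · subst hk
    exact Nat.sub_le _ _
  · exact le_rfl

/-- A nonzero bundle of at most `Δ` units contains a unit whose price is at least the `Δ`-th
part of the price of the bundle. -/
theorem exists_dotp_le_mul_price {m Δ : ℕ} (p : Fin m → ℝ) (hp : ∀ j, 0 ≤ p j) (x : Bundle m)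
    (hx : x ≠ 0) (hsize : ∑ j, x j ≤ Δ) : ∃ j, x j ≠ 0 ∧ dotp p x ≤ Δ * p j := by
  obtain ⟨k, hk⟩ := Function.ne_iff.mp hx
  obtain ⟨j, hj, hmax⟩ := (univ.filter fun j => x j ≠ 0).exists_max_image p ⟨k, by simpa using hk⟩
  refine ⟨j, by simpa using hj, ?_⟩
  calc dotp p x ≤ ∑ k, p j * (x k : ℝ) := by
        refine sum_le_sum fun k _ => ?_
        by_cases hk : x k = 0
        · simp [hk]
        · exact mul_le_mul_of_nonneg_right (hmax k (by simpa using hk)) (Nat.cast_nonneg _)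
    _ = ((∑ k, x k : ℕ) : ℝ) * p j := by rw [← mul_sum, Nat.cast_sum, mul_comm]
    _ ≤ Δ * p j := mul_le_mul_of_nonneg_right (by exact_mod_cast hsize) (hp j)

/-- If the price of a bundle of at most `Δ` units exceeds `b` by at most a factor `Δ / (Δ - 1)`,
then removing one suitable unit brings the price down to at most `b`. -/
theorem exists_dotp_removeOne_le {m Δ : ℕ} (hΔ : 2 ≤ Δ) (hm : 0 < m) (p : Fin m → ℝ)
    (hp : ∀ j, 0 ≤ p j) {b : ℝ} (hb : 0 ≤ b) (x : Bundle m) (hsize : ∑ j, x j ≤ Δ)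
    (hx : dotp p x ≤ ((Δ : ℝ) / ((Δ : ℝ) - 1)) * b) : ∃ j, dotp p (removeOne x j) ≤ b := by
  by_cases hx0 : x = 0
  · exact ⟨⟨0, hm⟩, by simpa [hx0, dotp, removeOne] using hb⟩
  obtain ⟨j, hj, hle⟩ := exists_dotp_le_mul_price p hp x hx0 hsize
  refine ⟨j, ?_⟩
  rw [dotp_removeOne p x j hj]
  have hΔ' : (2 : ℝ) ≤ Δ := by exact_mod_cast hΔ
  rw [div_mul_eq_mul_div, le_div_iff₀ (by linarith)] at hx
  refine le_of_mul_le_mul_left (a := (Δ : ℝ)) ?_ (by linarith)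
  linarith

/-- **Ex-post EF1 from small budget supports** (Theorem 5(ii)): with a common, downward-closed
acceptable set, `Δ ≥ 2`, and two agents whose budgets lie in `[b, (Δ/(Δ-1))·b]`, agent `i`'s
demanded bundle is weakly preferred (by `≻ᵢ`) to agent `i'`'s demanded bundle with one unit of
some good removed. Consequently every allocation in the support of an ex-post implementation
of a CERI whose budget distributions are supported in `[b, (Δ/(Δ-1))·b]` is EF1. -/
theorem ceri_expost_ef1
    (n m Δ : ℕ) (hΔ : 2 ≤ Δ) (hm : 0 < m)
    (Ψ : Finset (Bundle m))
    (hzero : (0 : Bundle m) ∈ Ψ)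
    (hsize : ∀ x ∈ Ψ, ∑ j, x j ≤ Δ)
    (hdownward : ∀ x ∈ Ψ, ∀ y : Bundle m, (∀ j, y j ≤ x j) → y ∈ Ψ)
    (pref : Fin n → Bundle m → Bundle m → Prop)
    (hirr : ∀ i, ∀ x ∈ Ψ, ¬ pref i x x)
    (htrans : ∀ i, ∀ x ∈ Ψ, ∀ y ∈ Ψ, ∀ z ∈ Ψ,
        pref i x y → pref i y z → pref i x z)
    (htotal : ∀ i, ∀ x ∈ Ψ, ∀ y ∈ Ψ, x ≠ y → pref i x y ∨ pref i y x)
    (hleast : ∀ i, ∀ x ∈ Ψ, x ≠ 0 → pref i x 0)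
    (D : Fin n → (Fin m → ℝ) → ℝ → Bundle m)
    (hD : ∀ (i : Fin n) (p : Fin m → ℝ) (b : ℝ), (∀ j, 0 ≤ p j) → 0 ≤ b →
        D i p b ∈ Ψ ∧ dotp p (D i p b) ≤ b ∧
        ∀ x ∈ Ψ, dotp p x ≤ b → x = D i p b ∨ pref i (D i p b) x)
    (p : Fin m → ℝ) (hp : ∀ j, 0 ≤ p j)
    (b : ℝ) (hb : 0 < b)
    (i i' : Fin n) (bi bi' : ℝ)
    (hbi_lo : b ≤ bi) (hbi_hi : bi ≤ ((Δ : ℝ) / ((Δ : ℝ) - 1)) * b)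
    (hbi'_lo : b ≤ bi') (hbi'_hi : bi' ≤ ((Δ : ℝ) / ((Δ : ℝ) - 1)) * b) :
    ∃ j : Fin m,
      D i p bi = removeOne (D i' p bi') j ∨
      pref i (D i p bi) (removeOne (D i' p bi') j) := by
  obtain ⟨hmem', hcost', -⟩ := hD i' p bi' hp (hb.le.trans hbi'_lo)
  obtain ⟨j, hj⟩ := exists_dotp_removeOne_le hΔ hm p hp hb.le _ (hsize _ hmem')
    (hcost'.trans hbi'_hi)
  refine ⟨j, ?_⟩
  obtain ⟨-, -, hbest⟩ := hD i p bi hp (hb.le.trans hbi_lo)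
  exact (hbest _ (hdownward _ hmem' _ (removeOne_le _ j)) (hj.trans hbi_lo)).imp_left Eq.symm
end
end

section
/- (Discrete First Welfare Theorem used in the paper.) Let p ∈ ℝ^m with p ≥ 0, let b_1,…,b_n ≥ 0 be budgets, and let x_i = D_i(p, b_i) be each agent's demanded bundle. Then the deterministic allocation (x_1,…,x_n) is Pareto efficient with respect to the capacity vector c′ = Σ_{i=1}^n x_i: there is no profile (y_1,…,y_n) with y_i ∈ Ψ_i, Σ_i y_i ≤ c′ coordinatewise, y_i ⪰_i x_i for all i, and y_i ≻_i x_i for at least one agent i. -/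
open Finset

noncomputable section

/-- A bundle strictly preferred to the best affordable one costs more than the budget. -/
theorem budget_lt_dotp_of_pref {m : ℕ} {S : Finset (Bundle m)}
    {r : Bundle m → Bundle m → Prop} (hirr : ∀ x ∈ S, ¬ r x x)
    (htrans : ∀ x ∈ S, ∀ y ∈ S, ∀ z ∈ S, r x y → r y z → r x z)
    {p : Fin m → ℝ} {b : ℝ} {d : Bundle m} (hd : d ∈ S)
    (hbest : ∀ x ∈ S, dotp p x ≤ b → x = d ∨ r d x)
    {y : Bundle m} (hy : y ∈ S) (hyd : r y d) : b < dotp p y := by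
  by_contra! hle
  rcases hbest y hy hle with rfl | hdy
  · exact hirr y hy hyd
  · exact hirr y hy (htrans y hy d hd y hy hyd hdy)

/-- At nonnegative prices, total cost is monotone in the aggregate bundle. -/
theorem sum_dotp_le_sum_dotp {ι : Type*} [Fintype ι] {m : ℕ} {p : Fin m → ℝ}
    (hp : ∀ j, 0 ≤ p j) {x y : ι → Bundle m} (h : ∀ j, ∑ i, y i j ≤ ∑ i, x i j) :
    ∑ i, dotp p (y i) ≤ ∑ i, dotp p (x i) := by
  simp only [dotp]
  rw [Finset.sum_comm, Finset.sum_comm (f := fun i j => p j * (x i j : ℝ))]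
  simp only [← Finset.mul_sum]
  exact Finset.sum_le_sum fun j _ => mul_le_mul_of_nonneg_left (mod_cast h j) (hp j)

/-- **Discrete First Welfare Theorem**: the allocation of demanded bundles
`x i = D i p (bud i)` at a common price vector `p ≥ 0` is Pareto efficient with respect to
the capacity vector `c' = ∑ i, x i`. -/
theorem discrete_first_welfare
    (n m : ℕ)
    (Ψ : Fin n → Finset (Bundle m))
    (hzero : ∀ i, (0 : Bundle m) ∈ Ψ i)
    (pref : Fin n → Bundle m → Bundle m → Prop)
    (hirr : ∀ i, ∀ x ∈ Ψ i, ¬ pref i x x)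
    (htrans : ∀ i, ∀ x ∈ Ψ i, ∀ y ∈ Ψ i, ∀ z ∈ Ψ i,
        pref i x y → pref i y z → pref i x z)
    (htotal : ∀ i, ∀ x ∈ Ψ i, ∀ y ∈ Ψ i, x ≠ y → pref i x y ∨ pref i y x)
    (hleast : ∀ i, ∀ x ∈ Ψ i, x ≠ 0 → pref i x 0)
    (D : Fin n → (Fin m → ℝ) → ℝ → Bundle m)
    (hD : ∀ (i : Fin n) (p : Fin m → ℝ) (b : ℝ), (∀ j, 0 ≤ p j) → 0 ≤ b →
        D i p b ∈ Ψ i ∧ dotp p (D i p b) ≤ b ∧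
        ∀ x ∈ Ψ i, dotp p x ≤ b → x = D i p b ∨ pref i (D i p b) x)
    (p : Fin m → ℝ) (hp : ∀ j, 0 ≤ p j)
    (bud : Fin n → ℝ) (hbud : ∀ i, 0 ≤ bud i) :
    ¬ ∃ y : Fin n → Bundle m,
      (∀ i, y i ∈ Ψ i) ∧
      (∀ j, ∑ i, y i j ≤ ∑ i, D i p (bud i) j) ∧
      (∀ i, y i = D i p (bud i) ∨ pref i (y i) (D i p (bud i))) ∧
      (∃ i, pref i (y i) (D i p (bud i))) := by
  rintro ⟨y, hy, hcap, hweak, k, hk⟩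
  have hstrict : ∀ i, pref i (y i) (D i p (bud i)) →
      dotp p (D i p (bud i)) < dotp p (y i) := fun i h =>
    (hD i p (bud i) hp (hbud i)).2.1.trans_lt
      (budget_lt_dotp_of_pref (hirr i) (htrans i) (hD i p (bud i) hp (hbud i)).1
        (hD i p (bud i) hp (hbud i)).2.2 (hy i) h)
  have hlt : ∑ i, dotp p (D i p (bud i)) < ∑ i, dotp p (y i) := by
    refine Finset.sum_lt_sum (fun i _ => ?_) ⟨k, Finset.mem_univ k, hstrict k hk⟩
    rcases hweak i with h | h
    · rw [h]
    · exact (hstrict i h).le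
  exact hlt.not_ge (sum_dotp_le_sum_dotp hp hcap)
end
end

section
/- Let τ ≥ 1 and λ ≥ 1 be integers, let ε ∈ (0,1], and assume λ ≥ 6τ/ε. Fix ψ ∈ ℕ^τ, and draw the random grid G(λ,τ). Then with probability at least 1 − ε/2 over the random grid, the coordinatewise round-up to the grid is constant on the set of integer vectors within ℓ∞-distance 1 of ψ: for every ψ′ ∈ ℕ^τ with |ψ′^t − ψ^t| ≤ 1 for all t, one has min{g ∈ G^t : g ≥ ψ′^t} = min{g ∈ G^t : g ≥ ψ^t} for every t (each minimum exists since G^t contains arbitrarily large integers). In particular, with probability at least 1 − ε/2, no change of a single agent's reported type can alter the grid point selected by the round-up. -/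
open Finset
open scoped Classical

noncomputable section

/-- The round-up of `x` to the grid line `{z + k·λ : k ∈ ℕ}`: the least grid point `≥ x`. -/
def roundUp (z lam x : ℕ) : ℕ :=
  sInf {g : ℕ | (∃ k : ℕ, g = z + k * lam) ∧ x ≤ g}

theorem roundUp_eq_of_le_iff {z lam x y : ℕ}
    (h : ∀ k : ℕ, x ≤ z + k * lam ↔ y ≤ z + k * lam) :
    roundUp z lam x = roundUp z lam y := by
  unfold roundUp
  congr 1
  ext g
  constructor
  · rintro ⟨⟨k, rfl⟩, hk⟩
    exact ⟨⟨k, rfl⟩, (h k).1 hk⟩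
  · rintro ⟨⟨k, rfl⟩, hk⟩
    exact ⟨⟨k, rfl⟩, (h k).2 hk⟩

/-- At most one offset in `{c, …, c + lam - 1}` has a given point on its grid line. -/
theorem card_offsets_through_le_one (lam c p : ℕ) :
    (univ.filter (fun z : Fin lam => ∃ k : ℕ, (z : ℕ) + c + k * lam = p)).card ≤ 1 := by
  refine card_le_one.2 fun a ha b hb => ?_
  obtain ⟨k, hk⟩ := (mem_filter.1 ha).2
  obtain ⟨l, hl⟩ := (mem_filter.1 hb).2
  have h : (a : ℕ) + k * lam = b + l * lam := by omega
  have hmod := congrArg (· % lam) h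
  simp only [Nat.add_mul_mod_self_right, Nat.mod_eq_of_lt a.isLt, Nat.mod_eq_of_lt b.isLt] at hmod
  exact Fin.ext hmod

/-- The offsets whose grid line passes through neither `p` nor `p - 1`. -/
def stableOffsets (lam p : ℕ) : Finset (Fin lam) :=
  (univ.filter (fun z => (∃ k : ℕ, (z : ℕ) + 1 + k * lam = p) ∨
    ∃ k : ℕ, (z : ℕ) + 2 + k * lam = p))ᶜ

theorem le_card_stableOffsets_add_two (lam p : ℕ) : lam ≤ (stableOffsets lam p).card + 2 := by
  have hcompl := card_compl_add_card (univ.filter (fun z : Fin lam =>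
    (∃ k : ℕ, (z : ℕ) + 1 + k * lam = p) ∨ ∃ k : ℕ, (z : ℕ) + 2 + k * lam = p))
  rw [Fintype.card_fin] at hcompl
  have hunion := card_union_le
    (univ.filter (fun z : Fin lam => ∃ k : ℕ, (z : ℕ) + 1 + k * lam = p))
    (univ.filter (fun z : Fin lam => ∃ k : ℕ, (z : ℕ) + 2 + k * lam = p))
  rw [← filter_or] at hunion
  have h₁ := card_offsets_through_le_one lam 1 p
  have h₂ := card_offsets_through_le_one lam 2 p
  unfold stableOffsets
  omega

theorem roundUp_eq_of_mem_stableOffsets {lam p q : ℕ} {z : Fin lam}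
    (hz : z ∈ stableOffsets lam p) (hq : |(q : ℤ) - (p : ℤ)| ≤ 1) :
    roundUp ((z : ℕ) + 1) lam q = roundUp ((z : ℕ) + 1) lam p := by
  simp only [stableOffsets, mem_compl, mem_filter, mem_univ, true_and, not_or, not_exists] at hz
  refine roundUp_eq_of_le_iff fun k => ?_
  have h₁ := hz.1 k
  have h₂ := hz.2 k
  have hq' := abs_le.1 hq
  omega

/-- **Stability of the grid round-up** (Lemma A.1, consequence): drawing the grid offsets
`z t ∈ {1,…,λ}` independently and uniformly (encoded as `z : Fin τ → Fin lam` with offset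
`(z t : ℕ) + 1`), if `λ ≥ 6τ/ε` then with probability at least `1 - ε/2` the coordinatewise
round-up to the grid is constant on all integer vectors within `ℓ∞`-distance 1 of `ψ`; in
particular no single agent's report can alter the selected grid point. -/
theorem random_grid_roundup_stable
    (τ lam : ℕ) (hτ : 1 ≤ τ) (hlam : 1 ≤ lam)
    (ε : ℝ) (hε : 0 < ε) (hε1 : ε ≤ 1)
    (hlamε : 6 * (τ : ℝ) / ε ≤ (lam : ℝ))
    (ψ : Fin τ → ℕ) :
    1 - ε / 2 ≤
      ((Finset.univ.filter (fun z : Fin τ → Fin lam =>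
          ∀ ψ' : Fin τ → ℕ, (∀ t, |(ψ' t : ℤ) - (ψ t : ℤ)| ≤ 1) →
            ∀ t : Fin τ,
              roundUp ((z t : ℕ) + 1) lam (ψ' t) =
                roundUp ((z t : ℕ) + 1) lam (ψ t))).card : ℝ)
        / ((lam : ℝ) ^ τ) := by
  have hτ' : (1 : ℝ) ≤ τ := by exact_mod_cast hτ
  have hpos : (0 : ℝ) < lam := by exact_mod_cast hlam
  have hmul : 6 * (τ : ℝ) ≤ lam * ε := (div_le_iff₀ hε).1 hlamε
  have hlam2 : (2 : ℝ) ≤ lam := by nlinarith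
  have hsub : Fintype.piFinset (fun t => stableOffsets lam (ψ t)) ⊆
      univ.filter (fun z : Fin τ → Fin lam =>
        ∀ ψ' : Fin τ → ℕ, (∀ t, |(ψ' t : ℤ) - (ψ t : ℤ)| ≤ 1) →
          ∀ t : Fin τ, roundUp ((z t : ℕ) + 1) lam (ψ' t) =
            roundUp ((z t : ℕ) + 1) lam (ψ t)) := fun z hz =>
    mem_filter.2 ⟨mem_univ z, fun ψ' hψ' t =>
      roundUp_eq_of_mem_stableOffsets (Fintype.mem_piFinset.1 hz t) (hψ' t)⟩
  have hcard : ((lam : ℝ) - 2) ^ τ ≤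
      ((Fintype.piFinset (fun t => stableOffsets lam (ψ t))).card : ℝ) := by
    rw [Fintype.card_piFinset, Nat.cast_prod]
    calc ((lam : ℝ) - 2) ^ τ = ∏ _t : Fin τ, ((lam : ℝ) - 2) := by simp
      _ ≤ _ := prod_le_prod (fun _ _ => by linarith) fun t _ => by
        have h : (lam : ℝ) ≤ (stableOffsets lam (ψ t)).card + 2 := by
          exact_mod_cast le_card_stableOffsets_add_two lam (ψ t)
        linarith
  have hfrac : 2 / (lam : ℝ) ≤ 1 := (div_le_one hpos).2 hlam2
  calc 1 - ε / 2 ≤ 1 + (τ : ℝ) * (-(2 / lam)) := by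
        have h : (τ : ℝ) * (2 / lam) ≤ ε / 2 := by
          rw [← mul_div_assoc, div_le_iff₀ hpos]
          nlinarith
        linarith
    _ ≤ (1 + -(2 / (lam : ℝ))) ^ τ := one_add_mul_le_pow (by linarith) τ
    _ = ((lam : ℝ) - 2) ^ τ / (lam : ℝ) ^ τ := by
        rw [← div_pow, sub_div, div_self hpos.ne', ← sub_eq_add_neg]
    _ ≤ _ := by
        gcongr
        exact hcard.trans (by exact_mod_cast card_le_card hsub)
end
end

section
/- Let D = (p_1,…,p_τ) be a probability vector on τ types with p_min := min_t p_t > 0, let ε ∈ (0,1], and let n be an integer with n ≥ (8τ)²/(ε²·p_min²). Draw n types independently according to D and let ψ^t denote the number of draws equal to t. Fix any positive integer λ and any grid offsets z^t ∈ {1,…,λ}, let G^t = {z^t + kλ : k ∈ ℕ}, and let ψ̄^t = min{g ∈ G^t : g ≥ ψ^t}. Then with probability at least 1 − ε/2 over the type draws, for every t ∈ {1,…,τ}: ψ^t ≥ (1 − λ/(0.5·p_min·n))·ψ̄^t. -/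
open Finset
open scoped Classical

noncomputable section

/-- Rounding up to a grid of step `lam` with offset `z ≤ lam` adds at most `lam`. -/
lemma roundUp_le_add {z lam : ℕ} (hlam : 1 ≤ lam) (hz : z ≤ lam) (x : ℕ) :
    roundUp z lam x ≤ x + lam := by
  rcases le_total x z with h | h
  · have hmem : z ∈ {g : ℕ | (∃ k : ℕ, g = z + k * lam) ∧ x ≤ g} := ⟨⟨0, by simp⟩, h⟩
    exact (Nat.sInf_le hmem).trans (hz.trans (Nat.le_add_left _ _))
  · have hdiv := Nat.div_add_mod' (x - z) lam
    have hmod := Nat.mod_lt (x - z) hlam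
    have hmul : ((x - z) / lam + 1) * lam = (x - z) / lam * lam + lam := by ring
    have hmem : z + ((x - z) / lam + 1) * lam ∈
        {g : ℕ | (∃ k : ℕ, g = z + k * lam) ∧ x ≤ g} :=
      ⟨⟨_, rfl⟩, by omega⟩
    exact (Nat.sInf_le hmem).trans (by omega)

/-- A count `x ≥ m` is at least `1 - lam / m` times its round-up. -/
lemma mul_roundUp_le {z lam : ℕ} (hlam : 1 ≤ lam) (hz : z ≤ lam) {x : ℕ} {m : ℝ}
    (hm : 0 < m) (hx : m ≤ x) :
    (1 - (lam : ℝ) / m) * (roundUp z lam x : ℝ) ≤ (x : ℝ) := by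
  rcases le_total (1 - (lam : ℝ) / m) 0 with h | h
  · exact (mul_nonpos_of_nonpos_of_nonneg h (Nat.cast_nonneg _)).trans (Nat.cast_nonneg _)
  · have hr : (roundUp z lam x : ℝ) ≤ x + lam := mod_cast roundUp_le_add hlam hz x
    have hq : 0 ≤ (lam : ℝ) / m := by positivity
    have hqm : (lam : ℝ) / m * m = lam := div_mul_cancel₀ _ hm.ne'
    calc (1 - (lam : ℝ) / m) * (roundUp z lam x : ℝ)
        ≤ (1 - (lam : ℝ) / m) * (x + lam) := mul_le_mul_of_nonneg_left hr h
      _ ≤ x := by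
        nlinarith [mul_le_mul_of_nonneg_left hx hq, mul_nonneg hq (Nat.cast_nonneg (α := ℝ) lam)]

/-- The exponential moment of a type count under i.i.d. draws. -/
lemma sum_prod_mul_exp_neg_count {α : Type*} [Fintype α] [DecidableEq α] (p : α → ℝ)
    (hpsum : ∑ a, p a = 1) (n : ℕ) (t : α) :
    ∑ ω : Fin n → α, (∏ i, p (ω i)) *
        Real.exp (-((univ.filter (fun i => ω i = t)).card : ℝ)) =
      (1 - p t * (1 - Real.exp (-1))) ^ n := by
  have hbase : ∑ a, p a * (if a = t then Real.exp (-1) else 1) =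
      1 - p t * (1 - Real.exp (-1)) := by
    have hsplit : ∀ a, p a * (if a = t then Real.exp (-1) else 1) =
        p a - if a = t then p a * (1 - Real.exp (-1)) else 0 := by
      intro a
      split_ifs <;> ring
    simp only [hsplit, sum_sub_distrib, hpsum, sum_ite_eq', mem_univ, if_true]
  rw [← hbase, Fintype.sum_pow]
  refine sum_congr rfl fun ω _ => ?_
  rw [prod_mul_distrib, prod_ite]
  simp [← Real.exp_nat_mul]

/-- Chernoff bound for the lower tail of a type count under i.i.d. draws. -/
lemma sum_prod_count_lt_le {α : Type*} [Fintype α] [DecidableEq α] (p : α → ℝ) (hpnn : ∀ a, 0 ≤ p a)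
    (hpsum : ∑ a, p a = 1) (n : ℕ) (t : α) :
    ∑ ω ∈ univ.filter (fun ω : Fin n → α =>
        ((univ.filter (fun i => ω i = t)).card : ℝ) < 0.5 * p t * n), ∏ i, p (ω i) ≤
      Real.exp (-(0.1 * p t * n)) := by
  have hle : p t ≤ 1 := hpsum ▸ single_le_sum (fun a _ => hpnn a) (mem_univ t)
  have he : Real.exp (-1) < 0.4 := Real.exp_neg_one_lt_d9.trans (by norm_num)
  have hmarkov : Real.exp (-(0.5 * p t * n)) * ∑ ω ∈ univ.filter (fun ω : Fin n → α =>
      ((univ.filter (fun i => ω i = t)).card : ℝ) < 0.5 * p t * n), ∏ i, p (ω i) ≤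
      (1 - p t * (1 - Real.exp (-1))) ^ n := by
    rw [← sum_prod_mul_exp_neg_count p hpsum, mul_sum]
    refine (sum_le_sum fun ω hω => ?_).trans (sum_le_sum_of_subset_of_nonneg
      (filter_subset _ _) fun ω _ _ =>
        mul_nonneg (prod_nonneg fun i _ => hpnn _) (Real.exp_pos _).le)
    rw [mul_comm]
    refine mul_le_mul_of_nonneg_left ?_ (prod_nonneg fun i _ => hpnn _)
    exact Real.exp_le_exp.2 (neg_le_neg (mem_filter.1 hω).2.le)
  have hpow : (1 - p t * (1 - Real.exp (-1))) ^ n ≤ Real.exp (-(0.6 * p t * n)) := by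
    have hbase : 1 - p t * (1 - Real.exp (-1)) ≤ Real.exp (-(0.6 * p t)) := by
      have := Real.add_one_le_exp (-(0.6 * p t))
      nlinarith [mul_le_mul_of_nonneg_left he.le (hpnn t)]
    have hnonneg : 0 ≤ 1 - p t * (1 - Real.exp (-1)) := by
      nlinarith [mul_nonneg (hpnn t) (Real.exp_pos (-1)).le]
    refine (pow_le_pow_left₀ hnonneg hbase n).trans_eq ?_
    rw [← Real.exp_nat_mul]
    ring_nf
  refine le_of_mul_le_mul_left (hmarkov.trans (hpow.trans_eq ?_)) (Real.exp_pos (-(0.5 * p t * n)))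
  rw [← Real.exp_add]
  ring_nf

/-- Union bound for weights on a finite type. -/
lemma sum_filter_exists_le {α β : Type*} [Fintype α] [Fintype β] (w : α → ℝ)
    (hw : ∀ a, 0 ≤ w a) (Q : β → α → Prop)
    [∀ b, DecidablePred (Q b)] [DecidablePred fun a => ∃ b, Q b a] :
    ∑ a ∈ univ.filter (fun a => ∃ b, Q b a), w a ≤
      ∑ b, ∑ a ∈ univ.filter (Q b), w a := by
  simp only [sum_filter]
  rw [sum_comm]
  refine sum_le_sum fun a _ => ?_
  have hnn : ∀ b ∈ univ, 0 ≤ if Q b a then w a else 0 := by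
    intro b _
    split_ifs
    exacts [hw a, le_rfl]
  split_ifs with h
  · obtain ⟨b, hb⟩ := h
    simpa [hb] using single_le_sum hnn (mem_univ b)
  · exact sum_nonneg hnn

/-- **Concentration of type counts relative to the grid round-up** (Lemma A.2): drawing
`n` types i.i.d. from the distribution `p` on `τ` types (the probability of a profile
`ω : Fin n → Fin τ` is `∏ i, p (ω i)`), if `n ≥ (8τ)²/(ε²·p_min²)` then with probability at
least `1 - ε/2`, for every type `t` the count `ψ t` of agents of type `t` satisfies
`ψ t ≥ (1 - λ/(0.5·p_min·n))·ψ̄ t`, where `ψ̄ t` is the round-up of `ψ t` to the grid. -/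
theorem type_counts_near_roundup
    (τ : ℕ) (hτ : 1 ≤ τ)
    (p : Fin τ → ℝ) (hpnn : ∀ t, 0 ≤ p t) (hpsum : ∑ t, p t = 1)
    (pmin : ℝ) (hpmin_le : ∀ t, pmin ≤ p t) (hpmin_mem : ∃ t, p t = pmin)
    (hpmin_pos : 0 < pmin)
    (ε : ℝ) (hε : 0 < ε) (hε1 : ε ≤ 1)
    (n : ℕ) (hn : (8 * (τ : ℝ)) ^ 2 / (ε ^ 2 * pmin ^ 2) ≤ (n : ℝ))
    (lam : ℕ) (hlam : 1 ≤ lam)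
    (z : Fin τ → ℕ) (hz : ∀ t, 1 ≤ z t ∧ z t ≤ lam) :
    1 - ε / 2 ≤
      ∑ ω ∈ Finset.univ.filter (fun ω : Fin n → Fin τ =>
          ∀ t : Fin τ,
            (1 - (lam : ℝ) / (0.5 * pmin * (n : ℝ))) *
              ((roundUp (z t) lam ((Finset.univ.filter (fun i : Fin n => ω i = t)).card)) : ℝ)
              ≤ (((Finset.univ.filter (fun i : Fin n => ω i = t)).card : ℕ) : ℝ)),
        ∏ i : Fin n, p (ω i) := by
  have hτ' : (1 : ℝ) ≤ τ := mod_cast hτ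
  have hpmin_one : pmin ≤ 1 := by
    obtain ⟨t, rfl⟩ := hpmin_mem
    exact hpsum ▸ single_le_sum (fun a _ => hpnn a) (mem_univ t)
  have hn' : (8 * (τ : ℝ)) ^ 2 ≤ n * (ε ^ 2 * pmin ^ 2) := (div_le_iff₀ (by positivity)).1 hn
  have hn0 : (0 : ℝ) < n := lt_of_lt_of_le (by positivity) hn
  have hlarge : 2 * τ / ε ≤ 0.1 * pmin * n := by
    rw [div_le_iff₀ hε]
    have hshrink : n * (ε ^ 2 * pmin ^ 2) ≤ n * (ε * pmin) := by
      gcongr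
      · exact pow_le_of_le_one hε.le hε1 two_ne_zero
      · exact pow_le_of_le_one hpmin_pos.le hpmin_one two_ne_zero
    nlinarith
  have htail : ∀ t, ∑ ω ∈ univ.filter (fun ω : Fin n → Fin τ =>
      ((univ.filter (fun i => ω i = t)).card : ℝ) < 0.5 * p t * n), ∏ i, p (ω i) ≤
      ε / (2 * τ) := by
    intro t
    refine (sum_prod_count_lt_le p hpnn hpsum n t).trans ?_
    have hexp : 2 * τ / ε ≤ Real.exp (0.1 * p t * n) := by
      have hmono : 0.1 * pmin * n ≤ 0.1 * p t * n := by gcongr; exact hpmin_le t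
      linarith [Real.add_one_le_exp (0.1 * p t * n)]
    rw [Real.exp_neg, ← inv_div (2 * (τ : ℝ)) ε]
    exact inv_anti₀ (by positivity) hexp
  have hbad : ∑ ω ∈ univ.filter (fun ω : Fin n → Fin τ => ∃ t,
      ((univ.filter (fun i => ω i = t)).card : ℝ) < 0.5 * p t * n), ∏ i, p (ω i) ≤ ε / 2 := by
    refine (sum_filter_exists_le _ (fun ω => prod_nonneg fun i _ => hpnn _) _).trans
      ((sum_le_sum fun t _ => htail t).trans_eq ?_)
    simp only [sum_const, card_univ, Fintype.card_fin, nsmul_eq_mul]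
    field_simp
  have htotal : ∑ ω : Fin n → Fin τ, ∏ i, p (ω i) = 1 := by
    rw [← Fintype.sum_pow, hpsum, one_pow]
  rw [← sum_filter_add_sum_filter_not univ (fun ω : Fin n → Fin τ => ∃ t,
    ((univ.filter (fun i => ω i = t)).card : ℝ) < 0.5 * p t * n)] at htotal
  refine (sub_le_iff_le_add'.2 (htotal.symm.le.trans (add_le_add_left hbad _))).trans
    (sum_le_sum_of_subset_of_nonneg (fun ω hω => ?_)
    fun ω _ _ => prod_nonneg fun i _ => hpnn _)
  simp only [mem_filter, mem_univ, true_and, not_exists, not_lt] at hω ⊢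
  intro t
  have hmono : 0.5 * pmin * n ≤ 0.5 * p t * n := by gcongr; exact hpmin_le t
  exact mul_roundUp_le hlam (hz t).2 (by positivity) (hmono.trans (hω t))
end
end

section
/- Assume every acceptable bundle is a 0/1 vector: Ψ_i ⊆ {0,1}^m for each agent i, with every x ∈ Ψ_i having at most Δ ones. Let (p, (B_1,…,B_n)) be a CERI with expected demands E_i(p). Then there exist budgets b_1,…,b_n, each b_i in the support of B_i, such that, setting x_i = D_i(p, b_i), ‖Σ_{i=1}^n x_i − Σ_{i=1}^n E_i(p)‖₂ ≤ √(Δ·m/2) (Euclidean norm). Consequently, the clipped excess demand vector z, defined by z_j = (Σ_i x_i − c)_j for goods j with p_j > 0 and z_j = max{(Σ_i x_i − c)_j, 0} for goods j with p_j = 0, satisfies ‖z‖₂ ≤ √(Δ·m/2). -/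
open MeasureTheory Finset

noncomputable section

section ShapleyFolkman

universe u v

variable {F : Type u} [NormedAddCommGroup F] [InnerProductSpace ℝ F]

lemma sum_mul_norm_add_sub_sq {κ : Type*} (s : Finset κ) (w : κ → ℝ) (x : κ → F) (μ a : F)
    (hw : ∑ k ∈ s, w k = 1) (hμ : ∑ k ∈ s, w k • x k = μ) :
    ∑ k ∈ s, w k * ‖a + (x k - μ)‖ ^ 2 = ‖a‖ ^ 2 + ∑ k ∈ s, w k * ‖x k - μ‖ ^ 2 := by
  have hcross : ∑ k ∈ s, w k * inner ℝ a (x k - μ) = 0 := by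
    have : ∑ k ∈ s, w k • (x k - μ) = 0 := by
      simp [smul_sub, Finset.sum_sub_distrib, ← Finset.sum_smul, hw, hμ]
    simp_rw [← real_inner_smul_right]
    rw [← inner_sum, this, inner_zero_right]
  calc ∑ k ∈ s, w k * ‖a + (x k - μ)‖ ^ 2
      = ∑ k ∈ s, (w k * ‖a‖ ^ 2 + 2 * (w k * inner ℝ a (x k - μ)) + w k * ‖x k - μ‖ ^ 2) :=
        Finset.sum_congr rfl fun k _ => by rw [norm_add_sq_real]; ring
    _ = _ := by
      rw [Finset.sum_add_distrib, Finset.sum_add_distrib, ← Finset.sum_mul, ← Finset.mul_sum,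
        hcross, hw]
      ring

/-- A weighted family of `s.card` points with pairwise squared distances at most `2 * R` has
variance at most `(s.card - 1) * R / 2`. -/
lemma sum_mul_norm_sub_sq_le {κ : Type*} (s : Finset κ) (w : κ → ℝ) (x : κ → F) (μ : F) (R : ℝ)
    (hR : 0 ≤ R) (hw0 : ∀ k ∈ s, 0 ≤ w k) (hw : ∑ k ∈ s, w k = 1)
    (hμ : ∑ k ∈ s, w k • x k = μ)
    (hx : ∀ k ∈ s, ∀ l ∈ s, ‖x k - x l‖ ^ 2 ≤ 2 * R) :
    ∑ k ∈ s, w k * ‖x k - μ‖ ^ 2 ≤ ((#s : ℝ) - 1) * R / 2 := by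
  classical
  set V := ∑ k ∈ s, w k * ‖x k - μ‖ ^ 2 with hV
  have hpair : ∀ k ∈ s, ‖x k - μ‖ ^ 2 + V ≤ 2 * R * (1 - w k) := by
    intro k hk
    have h := sum_mul_norm_add_sub_sq s w x μ (μ - x k) hw hμ
    rw [norm_sub_rev μ (x k), ← hV] at h
    rw [← h, ← hw, ← Finset.add_sum_erase s _ hk, ← Finset.add_sum_erase s w hk,
      add_sub_cancel_left, Finset.mul_sum]
    simp only [sub_add_sub_cancel, sub_self, norm_zero]
    simp only [ne_eq, OfNat.ofNat_ne_zero, not_false_eq_true, zero_pow, mul_zero, zero_add]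
    refine Finset.sum_le_sum fun l hl => ?_
    have hl' := Finset.mem_of_mem_erase hl
    have := mul_le_mul_of_nonneg_left (hx l hl' k hk) (hw0 l hl')
    rw [sub_add_sub_comm, add_comm μ, add_sub_add_right_eq_sub]
    linarith
  have hsum : V + V ≤ 2 * R * (1 - ∑ k ∈ s, w k ^ 2) := by
    have h := Finset.sum_le_sum fun k hk => mul_le_mul_of_nonneg_left (hpair k hk) (hw0 k hk)
    calc V + V = ∑ k ∈ s, w k * (‖x k - μ‖ ^ 2 + V) := by
          simp_rw [mul_add]
          rw [Finset.sum_add_distrib, ← Finset.sum_mul, hw, one_mul]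
      _ ≤ _ := h
      _ = 2 * R * (∑ k ∈ s, w k - ∑ k ∈ s, w k ^ 2) := by
          rw [← Finset.sum_sub_distrib, Finset.mul_sum]
          exact Finset.sum_congr rfl fun k _ => by ring
      _ = _ := by rw [hw]
  have hcs : 1 ≤ (#s : ℝ) * ∑ k ∈ s, w k ^ 2 := by
    have := sq_sum_le_card_mul_sum_sq (s := s) (f := w)
    rwa [hw, one_pow] at this
  have hQ : 0 ≤ ∑ k ∈ s, w k ^ 2 := Finset.sum_nonneg fun _ _ => sq_nonneg _
  have hne : s.Nonempty := by
    rw [Finset.nonempty_iff_ne_empty]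
    rintro rfl
    simp at hw
  obtain h1 | h2 : #s = 1 ∨ 2 ≤ #s := by have := hne.card_pos; omega
  · rw [h1] at hcs ⊢
    norm_num at hcs ⊢
    nlinarith
  · have h2' : (2 : ℝ) ≤ #s := by exact_mod_cast h2
    have hkey : 1 - ∑ k ∈ s, w k ^ 2 ≤ ((#s : ℝ) - 1) / 2 := by nlinarith
    nlinarith

/-- The method of conditional expectations for independent rounding. -/
lemma exists_norm_add_sum_sub_sq_le {ι κ : Type*} (S : Finset ι) (s : ι → Finset κ) (w : κ → ℝ)
    (x : κ → F) (μ : ι → F) (hw0 : ∀ k, 0 ≤ w k) (hw : ∀ i, ∑ k ∈ s i, w k = 1)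
    (hμ : ∀ i, ∑ k ∈ s i, w k • x k = μ i) :
    ∃ f : ι → κ, (∀ i, f i ∈ s i) ∧ ‖∑ i ∈ S, (x (f i) - μ i)‖ ^ 2 ≤
      ∑ i ∈ S, ∑ k ∈ s i, w k * ‖x k - μ i‖ ^ 2 := by
  classical
  induction S using Finset.induction_on with
  | empty =>
    have hne : ∀ i, (s i).Nonempty := fun i => by
      rw [Finset.nonempty_iff_ne_empty]
      intro h
      simpa [h] using hw i
    choose f hf using hne
    exact ⟨f, hf, by simp⟩
  | insert i S hi ih =>
    obtain ⟨f, hf, hle⟩ := ih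
    set a := ∑ i ∈ S, (x (f i) - μ i)
    obtain ⟨k, hk, hkle⟩ : ∃ k ∈ s i, ‖a + (x k - μ i)‖ ^ 2 ≤
        ‖a‖ ^ 2 + ∑ k ∈ s i, w k * ‖x k - μ i‖ ^ 2 := by
      have h := sum_mul_norm_add_sub_sq (s i) w x (μ i) a (hw i) (hμ i)
      by_contra! hlt
      rw [← h] at hlt
      set T := ∑ k ∈ s i, w k * ‖a + (x k - μ i)‖ ^ 2
      obtain ⟨k, hk, hpos⟩ : ∃ k ∈ s i, 0 < w k :=
        Finset.exists_lt_of_sum_lt (f := fun _ => (0 : ℝ)) (by simp [hw i])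
      have : ∑ k ∈ s i, w k * T < T :=
        Finset.sum_lt_sum (fun k hk => mul_le_mul_of_nonneg_left (hlt k hk).le (hw0 k))
          ⟨k, hk, mul_lt_mul_of_pos_left (hlt k hk) hpos⟩
      rw [← Finset.sum_mul, hw i, one_mul] at this
      exact this.false
    refine ⟨Function.update f i k, fun j => ?_, ?_⟩
    · by_cases hj : j = i
      · subst hj; simpa using hk
      · simpa [hj] using hf j
    · have hcongr : ∑ j ∈ S, (x (Function.update f i k j) - μ j) = a :=
        Finset.sum_congr rfl fun j hj => by
          rw [Function.update_of_ne (ne_of_mem_of_not_mem hj hi)]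
      rw [Finset.sum_insert hi, Finset.sum_insert hi, hcongr, Function.update_self, add_comm]
      linarith

/-- A Carathéodory-type bound: points of the convex hulls of finitely many sets are written as
convex combinations whose total number of terms is at most `finrank ℝ F` plus the number of
sets. -/
lemma exists_convex_combinations_card_le [FiniteDimensional ℝ F] {ι : Type v} [Fintype ι]
    [Nonempty ι] [DecidableEq ι] (A : ι → Set F) (y : ι → F)
    (hy : ∀ i, y i ∈ convexHull ℝ (A i)) :
    ∃ (κ : Type (max u v)) (_ : Fintype κ) (a : κ → ι) (x : κ → F) (w : κ → ℝ),
      (∀ k, x k ∈ A (a k)) ∧ (∀ k, 0 ≤ w k) ∧ (∀ i, ∑ k with a k = i, w k = 1) ∧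
      ∑ k, w k • x k = ∑ i, y i ∧
      Fintype.card κ ≤ Module.finrank ℝ F + Fintype.card ι := by
  set N : ℝ := (Fintype.card ι : ℝ)
  have hN : 0 < N := by simpa [N] using Fintype.card_pos (α := ι)
  let S : Set (F × (ι → ℝ)) := ⋃ i, A i ×ˢ {Pi.single i 1}
  have hmem : ∑ i, N⁻¹ • (y i, (Pi.single i 1 : ι → ℝ)) ∈ convexHull ℝ S := by
    refine (convex_convexHull ℝ S).sum_mem (fun _ _ => by positivity) ?_ fun i _ => ?_
    · simp [N, hN.ne']
    · refine convexHull_mono (Set.subset_iUnion _ i) ?_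
      rw [convexHull_prod]
      exact ⟨hy i, by simp⟩
  obtain ⟨κ, hκ, z, w, hz, haff, hw0, hw1, hwz⟩ := eq_pos_convex_span_of_mem_convexHull hmem
  have hz' : ∀ k, ∃ i, z k ∈ A i ×ˢ {(Pi.single i 1 : ι → ℝ)} := fun k => by
    simpa only [S, Set.mem_iUnion] using hz (Set.mem_range_self k)
  choose a ha using hz'
  have hsnd : ∀ k, (z k).2 = Pi.single (a k) 1 := fun k => (ha k).2
  refine ⟨κ, hκ, a, fun k => (z k).1, fun k => N * w k, fun k => (ha k).1,
    fun k => mul_nonneg hN.le (hw0 k).le, fun i => ?_, ?_, ?_⟩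
  · have h := congrFun (congrArg Prod.snd hwz) i
    simp only [Prod.snd_sum, Prod.smul_snd, hsnd, Finset.sum_apply, Pi.smul_apply, smul_eq_mul,
      Pi.single_apply, mul_ite, mul_one, mul_zero, Finset.sum_ite_eq, Finset.mem_univ,
      if_true] at h
    rw [← Finset.mul_sum, Finset.sum_filter]
    simp_rw [eq_comm (a := i)] at h
    rw [h, mul_inv_cancel₀ hN.ne']
  · have h := congrArg Prod.fst hwz
    simp only [Prod.fst_sum, Prod.smul_fst] at h
    simp_rw [mul_smul]
    rw [← Finset.smul_sum, h, ← Finset.smul_sum, smul_inv_smul₀ hN.ne']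
  · have hlin : LinearIndependent ℝ z := by
      rw [Fintype.linearIndependent_iff]
      intro g hg k
      refine affineIndependent_iff.1 haff Finset.univ g ?_ hg k (Finset.mem_univ k)
      have h := congrArg (fun v : F × (ι → ℝ) => ∑ i, v.2 i) hg
      simp only [Prod.snd_sum, Prod.smul_snd, hsnd, Finset.sum_apply, Pi.smul_apply] at h
      rw [Finset.sum_comm] at h
      simpa [Pi.single_apply] using h
    simpa using hlin.fintype_card_le_finrank

/-- A quantitative Shapley–Folkman theorem for sets whose squared diameters are at most
`2 * R`. -/
theorem exists_norm_sum_sub_sum_sq_le [FiniteDimensional ℝ F] {ι : Type v} [Fintype ι]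
    (A : ι → Set F) (y : ι → F) (R : ℝ) (hR : 0 ≤ R) (hy : ∀ i, y i ∈ convexHull ℝ (A i))
    (hA : ∀ i, ∀ u ∈ A i, ∀ v ∈ A i, ‖u - v‖ ^ 2 ≤ 2 * R) :
    ∃ x : ι → F, (∀ i, x i ∈ A i) ∧
      ‖∑ i, x i - ∑ i, y i‖ ^ 2 ≤ R * Module.finrank ℝ F / 2 := by
  classical
  cases isEmpty_or_nonempty ι with
  | inl h => exact ⟨fun i => isEmptyElim i, fun i => isEmptyElim i, by simp; positivity⟩
  | inr h =>
    obtain ⟨κ, hκ, a, x, w, hx, hw0, hw1, hsum, hcard⟩ :=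
      exists_convex_combinations_card_le A y hy
    let s : ι → Finset κ := fun i => {k | a k = i}
    let μ : ι → F := fun i => ∑ k ∈ s i, w k • x k
    have hs : ∀ i, ∀ k ∈ s i, x k ∈ A i := fun i k hk => by
      obtain rfl : a k = i := by simpa [s] using hk
      exact hx k
    have hμ : ∑ i, μ i = ∑ i, y i := by
      rw [← hsum]
      exact Finset.sum_fiberwise _ a fun k => w k • x k
    have hcards : ∑ i, #(s i) = Fintype.card κ :=
      (Finset.card_eq_sum_card_fiberwise (f := a) (s := Finset.univ) (t := Finset.univ)
        (by simp)).symm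
    obtain ⟨f, hf, hle⟩ :=
      exists_norm_add_sum_sub_sq_le Finset.univ s w x μ hw0 hw1 fun _ => rfl
    refine ⟨fun i => x (f i), fun i => hs i _ (hf i), ?_⟩
    rw [← hμ, ← Finset.sum_sub_distrib]
    calc _ ≤ _ := hle
      _ ≤ ∑ i, ((#(s i) : ℝ) - 1) * R / 2 := Finset.sum_le_sum fun i _ =>
          sum_mul_norm_sub_sq_le (s i) w x (μ i) R hR (fun k _ => hw0 k) (hw1 i) rfl
            fun k hk l hl => hA i _ (hs i k hk) _ (hs i l hl)
      _ = ((Fintype.card κ : ℝ) - Fintype.card ι) * R / 2 := by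
          rw [← Finset.sum_div, ← Finset.sum_mul, Finset.sum_sub_distrib, ← hcards]
          simp
      _ ≤ _ := by
          have : (Fintype.card κ : ℝ) ≤ Module.finrank ℝ F + Fintype.card ι := by
            exact_mod_cast hcard
          nlinarith

end ShapleyFolkman

lemma norm_toLp_sub_sq_le {m Δ : ℕ} {x y : Bundle m} (hx : ∀ j, x j ≤ 1) (hy : ∀ j, y j ≤ 1)
    (hxs : ∑ j, x j ≤ Δ) (hys : ∑ j, y j ≤ Δ) :
    ‖(WithLp.toLp 2 fun j => (x j : ℝ)) - (WithLp.toLp 2 fun j => (y j : ℝ))‖ ^ 2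
      ≤ 2 * (Δ : ℝ) := by
  rw [EuclideanSpace.real_norm_sq_eq]
  calc _ ≤ ∑ j, ((x j : ℝ) + y j) := Finset.sum_le_sum fun j _ => by
        have hxj := hx j
        have hyj := hy j
        simp only [PiLp.sub_apply]
        interval_cases x j <;> interval_cases y j <;> norm_num
    _ ≤ _ := by
        have hxs' : ∑ j, (x j : ℝ) ≤ Δ := by exact_mod_cast hxs
        have hys' : ∑ j, (y j : ℝ) ≤ Δ := by exact_mod_cast hys
        rw [Finset.sum_add_distrib]
        linarith

/-- A demand function with values in `Ψ` takes each value on an interval of budgets, so its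
level sets have total mass one. -/
lemma sum_measure_demand_eq_one {m : ℕ} (Ψ : Finset (Bundle m))
    (pref : Bundle m → Bundle m → Prop) (hirr : ∀ x ∈ Ψ, ¬ pref x x)
    (htrans : ∀ x ∈ Ψ, ∀ y ∈ Ψ, ∀ z ∈ Ψ, pref x y → pref y z → pref x z)
    (p : Fin m → ℝ) (d : ℝ → Bundle m)
    (hd : ∀ b, 0 ≤ b → d b ∈ Ψ ∧ dotp p (d b) ≤ b ∧
      ∀ x ∈ Ψ, dotp p x ≤ b → x = d b ∨ pref (d b) x)
    (B : Measure ℝ) [IsProbabilityMeasure B] (hB : B {b | b < 0} = 0) :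
    ∑ x ∈ Ψ, (B {b | d b = x}).toReal = 1 := by
  have hconn : ∀ x, ({b | d b = x} ∩ Set.Ici 0).OrdConnected := by
    intro x
    refine ⟨?_⟩
    rintro b₁ ⟨rfl, h₁⟩ b₃ ⟨h₃, -⟩ b₂ ⟨h₁₂, h₂₃⟩
    have h₁ : 0 ≤ b₁ := h₁
    have h₂ : 0 ≤ b₂ := h₁.trans h₁₂
    have h₃ : d b₃ = d b₁ := h₃
    refine ⟨?_, h₂⟩
    obtain ⟨m₁, le₁, -⟩ := hd b₁ h₁
    obtain ⟨m₂, le₂, max₂⟩ := hd b₂ h₂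
    obtain ⟨-, -, max₃⟩ := hd b₃ (h₂.trans h₂₃)
    rw [h₃] at max₃
    rcases max₂ _ m₁ (le₁.trans h₁₂) with h | h
    · exact h.symm
    · rcases max₃ _ m₂ (le₂.trans h₂₃) with h' | h'
      · exact h'
      · exact (hirr _ m₁ (htrans _ m₁ _ m₂ _ m₁ h' h)).elim
  have hcompl : B (Set.Ici (0 : ℝ))ᶜ = 0 := by
    rw [Set.compl_Ici]
    exact hB
  have hnull : ∀ x ∈ Ψ, NullMeasurableSet {b | d b = x} B := fun x _ =>
    (hconn x).measurableSet.nullMeasurableSet.congr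
      (inter_ae_eq_left_of_ae_eq_univ (ae_eq_univ.2 hcompl))
  rw [← ENNReal.toReal_sum fun x _ => measure_ne_top B _,
    ← measure_biUnion_finset₀ (fun x _ y _ hxy => Disjoint.aedisjoint ?_) hnull]
  · have : B (⋃ x ∈ Ψ, {b | d b = x}) = 1 := by
      rw [← prob_compl_eq_zero_iff₀ (Finset.nullMeasurableSet_biUnion Ψ hnull)]
      refine measure_mono_null (fun b hb => ?_) hB
      by_contra hb0
      simp only [Set.mem_compl_iff, Set.mem_iUnion] at hb
      exact hb ⟨d b, (hd b (not_lt.1 hb0)).1, rfl⟩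
    exact congrArg ENNReal.toReal this
  · exact Set.disjoint_left.2 fun b hx hy => hxy (hx.symm.trans hy)

/-- **CERI implies ACEEI** (Proposition B.1): with 0/1 bundles of size at most `Δ`, any CERI
admits budgets `b i` in the support of `B i` such that the demanded allocation's distance
from the expected CERI allocation is at most `√(Δm/2)` in the `ℓ²`-norm; consequently the
clipped excess demand vector has `ℓ²`-norm at most `√(Δm/2)`. -/
theorem ceri_implies_aceei
    (n m Δ : ℕ) (hΔ : 0 < Δ)
    (c : Fin m → ℕ)
    (Ψ : Fin n → Finset (Bundle m))
    (hzero : ∀ i, (0 : Bundle m) ∈ Ψ i)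
    (h01 : ∀ i, ∀ x ∈ Ψ i, ∀ j, x j ≤ 1)
    (hsize : ∀ i, ∀ x ∈ Ψ i, ∑ j, x j ≤ Δ)
    (pref : Fin n → Bundle m → Bundle m → Prop)
    (hirr : ∀ i, ∀ x ∈ Ψ i, ¬ pref i x x)
    (htrans : ∀ i, ∀ x ∈ Ψ i, ∀ y ∈ Ψ i, ∀ z ∈ Ψ i,
        pref i x y → pref i y z → pref i x z)
    (htotal : ∀ i, ∀ x ∈ Ψ i, ∀ y ∈ Ψ i, x ≠ y → pref i x y ∨ pref i y x)
    (hleast : ∀ i, ∀ x ∈ Ψ i, x ≠ 0 → pref i x 0)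
    (D : Fin n → (Fin m → ℝ) → ℝ → Bundle m)
    (hD : ∀ (i : Fin n) (p : Fin m → ℝ) (b : ℝ), (∀ j, 0 ≤ p j) → 0 ≤ b →
        D i p b ∈ Ψ i ∧ dotp p (D i p b) ≤ b ∧
        ∀ x ∈ Ψ i, dotp p x ≤ b → x = D i p b ∨ pref i (D i p b) x)
    (B : Fin n → Measure ℝ)
    (hBprob : ∀ i, IsProbabilityMeasure (B i))
    (hBnonneg : ∀ i, B i {b | b < 0} = 0)
    -- the CERI conditions for price vector `p`
    (p : Fin m → ℝ) (hp : ∀ j, 0 ≤ p j)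
    (hmarket_le : ∀ j,
        ∑ i, ∑ x ∈ Ψ i, (B i {b | D i p b = x}).toReal * (x j : ℝ) ≤ (c j : ℝ))
    (hmarket_eq : ∀ j, 0 < p j →
        ∑ i, ∑ x ∈ Ψ i, (B i {b | D i p b = x}).toReal * (x j : ℝ) = (c j : ℝ)) :
    ∃ b : Fin n → ℝ,
      -- each `b i` lies in the (topological) support of `B i`
      (∀ i, ∀ δ : ℝ, 0 < δ → 0 < B i (Set.Ioo (b i - δ) (b i + δ))) ∧
      Real.sqrt (∑ j,
          ((∑ i, (D i p (b i) j : ℝ)) -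
            ∑ i, ∑ x ∈ Ψ i, (B i {b' | D i p b' = x}).toReal * (x j : ℝ)) ^ 2)
        ≤ Real.sqrt ((Δ : ℝ) * (m : ℝ) / 2) ∧
      Real.sqrt (∑ j,
          (if 0 < p j then (∑ i, (D i p (b i) j : ℝ)) - (c j : ℝ)
           else max ((∑ i, (D i p (b i) j : ℝ)) - (c j : ℝ)) 0) ^ 2)
        ≤ Real.sqrt ((Δ : ℝ) * (m : ℝ) / 2) := by
  let v : Bundle m → EuclideanSpace ℝ (Fin m) := fun x => WithLp.toLp 2 fun j => (x j : ℝ)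
  let A : Fin n → Set (EuclideanSpace ℝ (Fin m)) := fun i =>
    v '' {x | x ∈ Ψ i ∧ B i {b | D i p b = x} ≠ 0}
  let y : Fin n → EuclideanSpace ℝ (Fin m) := fun i =>
    ∑ x ∈ Ψ i, (B i {b | D i p b = x}).toReal • v x
  have hy : ∀ i, y i ∈ convexHull ℝ (A i) := by
    intro i
    have hsum := sum_measure_demand_eq_one (Ψ i) (pref i) (hirr i) (htrans i) p (D i p)
      (fun b => hD i p b hp) (B i) (hBnonneg i)
    have hfilter : ∑ x ∈ Ψ i with B i {b | D i p b = x} ≠ 0,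
        (B i {b | D i p b = x}).toReal • v x = y i :=
      Finset.sum_filter_of_ne fun x _ h => fun h0 => h (by simp [h0])
    rw [← hfilter]
    refine (convex_convexHull ℝ (A i)).sum_mem (fun _ _ => ENNReal.toReal_nonneg) ?_ ?_
    · rw [← hsum]
      exact Finset.sum_filter_of_ne fun x _ h => fun h0 => h (by simp [h0])
    · intro x hx
      exact subset_convexHull ℝ _ ⟨x, Finset.mem_filter.1 hx, rfl⟩
  obtain ⟨x, hx, hle⟩ := exists_norm_sum_sub_sum_sq_le A y Δ (Nat.cast_nonneg Δ) hy <| by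
    rintro i _ ⟨u, ⟨hu, -⟩, rfl⟩ _ ⟨w, ⟨hw, -⟩, rfl⟩
    exact norm_toLp_sub_sq_le (h01 i u hu) (h01 i w hw) (hsize i u hu) (hsize i w hw)
  have hb : ∀ i, ∃ b, b ∈ (B i).support ∧ v (D i p b) = x i := by
    intro i
    obtain ⟨u, ⟨-, hpos⟩, hu⟩ := hx i
    obtain ⟨b, hb, hbs⟩ := Measure.nonempty_inter_support_of_pos (pos_iff_ne_zero.2 hpos)
    exact ⟨b, hbs, by rw [← hu]; exact congrArg v hb⟩
  choose b hbs hbx using hb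
  have hbound : ∑ j, ((∑ i, (D i p (b i) j : ℝ)) -
      ∑ i, ∑ x ∈ Ψ i, (B i {b' | D i p b' = x}).toReal * (x j : ℝ)) ^ 2
        ≤ (Δ : ℝ) * (m : ℝ) / 2 := by
    rw [EuclideanSpace.real_norm_sq_eq, finrank_euclideanSpace_fin] at hle
    simpa [← hbx, y, v] using hle
  refine ⟨b, fun i δ hδ => ?_, Real.sqrt_le_sqrt hbound,
    Real.sqrt_le_sqrt ((Finset.sum_le_sum fun j _ => ?_).trans hbound)⟩
  · exact (Measure.mem_support_iff_forall (b i)).1 (hbs i) _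
      (Ioo_mem_nhds (by linarith) (by linarith))
  · split_ifs with hpj
    · rw [hmarket_eq j hpj]
    · rw [sq_le_sq, abs_of_nonneg (le_max_right _ _)]
      exact max_le ((sub_le_sub_left (hmarket_le j) _).trans (le_abs_self _)) (abs_nonneg _)
end
end

section
/- (Improved Shapley–Folkman bound.) Let S_1,…,S_n be nonempty compact subsets of ℝ^m, let D = max_{1 ≤ i ≤ n} diam(S_i) be the maximum Euclidean diameter of the sets, and let c belong to the convex hull of the Minkowski sum S_1 + S_2 + ⋯ + S_n. Then there exist points x_i ∈ S_i for each i such that ‖c − Σ_{i=1}^n x_i‖₂ ≤ D·√m/2. -/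
open Finset

noncomputable section

/-- The variance of a weighted finite family with pairwise distances at most `D` is at most
`D ^ 2 / 4` times the number of points minus one. -/
theorem weighted_variance_le {E ι : Type*} [NormedAddCommGroup E] [InnerProductSpace ℝ E]
    (F : Finset ι) (w : ι → ℝ) (s : ι → E) (D : ℝ)
    (hw : ∀ k ∈ F, 0 ≤ w k) (hw1 : ∑ k ∈ F, w k = 1)
    (hD : ∀ j ∈ F, ∀ k ∈ F, ‖s j - s k‖ ≤ D) :
    ∑ k ∈ F, w k * ‖s k - ∑ j ∈ F, w j • s j‖ ^ 2 ≤ D ^ 2 / 4 * ((#F : ℝ) - 1) := by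
  classical
  set y := ∑ j ∈ F, w j • s j with hy
  set V := ∑ k ∈ F, w k * ‖s k - y‖ ^ 2
  have hmean : ∑ k ∈ F, w k • (s k - y) = 0 := by
    simp only [smul_sub, sum_sub_distrib, ← sum_smul, hw1, one_smul, ← hy, sub_self]
  have hpair : ∑ j ∈ F, ∑ k ∈ F, w j * w k * ‖s j - s k‖ ^ 2 = 2 * V := by
    have hinner (j : ι) : ∑ k ∈ F, w k * inner ℝ (s j - y) (s k - y) = 0 := by
      simp_rw [← real_inner_smul_right, ← inner_sum, hmean, inner_zero_right]
    have hj (j : ι) : ∑ k ∈ F, w j * w k * ‖s j - s k‖ ^ 2 = w j * ‖s j - y‖ ^ 2 + w j * V := by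
      have h (k : ι) : w j * w k * ‖s j - s k‖ ^ 2 = (w j * ‖s j - y‖ ^ 2) * w k
          - (2 * w j) * (w k * inner ℝ (s j - y) (s k - y)) + w j * (w k * ‖s k - y‖ ^ 2) := by
        rw [← sub_sub_sub_cancel_right (s j) (s k) y, norm_sub_sq_real]
        ring
      simp_rw [h, sum_add_distrib, sum_sub_distrib, ← mul_sum, hinner, hw1]
      ring
    simp_rw [hj, sum_add_distrib, ← sum_mul, hw1]
    ring
  have hle : ∑ j ∈ F, ∑ k ∈ F, w j * w k * ‖s j - s k‖ ^ 2
      ≤ D ^ 2 * (1 - ∑ k ∈ F, w k ^ 2) := by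
    calc _ ≤ ∑ j ∈ F, ∑ k ∈ F, (D ^ 2 * (w j * w k) - if j = k then D ^ 2 * w j ^ 2 else 0) := by
          refine sum_le_sum fun j hj => sum_le_sum fun k hk => ?_
          split_ifs with h
          · subst h
            simp only [sub_self, norm_zero]
            apply le_of_eq
            ring
          · have h1 := pow_le_pow_left₀ (norm_nonneg _) (hD j hj k hk) 2
            have h2 := mul_le_mul_of_nonneg_left h1 (mul_nonneg (hw j hj) (hw k hk))
            linarith
      _ = _ := by
          simp_rw [sum_sub_distrib, ← mul_sum, hw1, sum_ite_eq]
          rw [sum_ite_mem, inter_self, ← mul_sum]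
          simp_rw [mul_one, hw1]
          ring
  have hcs : 1 ≤ (#F : ℝ) * ∑ k ∈ F, w k ^ 2 := by
    simpa [hw1] using sq_sum_le_card_mul_sum_sq (s := F) (f := w)
  have hpos : 0 < #F := by
    rw [card_pos, nonempty_iff_ne_empty]
    rintro rfl
    simp at hw1
  have hcard : (0 : ℝ) ≤ ((#F : ℝ) - 1) * ((#F : ℝ) - 2) := by
    rcases Nat.lt_or_ge #F 2 with h | h
    · simp [show #F = 1 by omega]
    · have : (2 : ℝ) ≤ #F := by exact_mod_cast h
      exact mul_nonneg (by linarith) (by linarith)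
  have hpos' : (0 : ℝ) < #F := by exact_mod_cast hpos
  have hkey : 2 * (1 - ∑ k ∈ F, w k ^ 2) ≤ (#F : ℝ) - 1 := by
    by_contra! h
    nlinarith [mul_lt_mul_of_pos_left h hpos']
  nlinarith [mul_le_mul_of_nonneg_left hkey (sq_nonneg D)]

/-- Some point of a weighted family is at least as good as the average for the squared distance
to a shifted barycenter. -/
theorem exists_norm_add_barycenter_sub_sq_le {E ι : Type*} [NormedAddCommGroup E]
    [InnerProductSpace ℝ E] (F : Finset ι) (w : ι → ℝ) (s : ι → E)
    (hw : ∀ k ∈ F, 0 < w k) (hw1 : ∑ k ∈ F, w k = 1) (v : E) :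
    ∃ k ∈ F, ‖v + (∑ j ∈ F, w j • s j - s k)‖ ^ 2
      ≤ ‖v‖ ^ 2 + ∑ k ∈ F, w k * ‖s k - ∑ j ∈ F, w j • s j‖ ^ 2 := by
  set y := ∑ j ∈ F, w j • s j with hy
  set V := ∑ k ∈ F, w k * ‖s k - y‖ ^ 2
  by_contra! h
  have hne : F.Nonempty := by
    rw [nonempty_iff_ne_empty]
    rintro rfl
    simp at hw1
  have hlt : ∑ k ∈ F, w k * (‖v‖ ^ 2 + V) < ∑ k ∈ F, w k * ‖v + (y - s k)‖ ^ 2 :=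
    sum_lt_sum_of_nonempty hne fun k hk => mul_lt_mul_of_pos_left (h k hk) (hw k hk)
  have hmean : ∑ k ∈ F, w k • (y - s k) = 0 := by
    simp only [smul_sub, sum_sub_distrib, ← sum_smul, hw1, one_smul, ← hy, sub_self]
  have hinner : ∑ k ∈ F, w k * inner ℝ v (y - s k) = 0 := by
    simp_rw [← real_inner_smul_right, ← inner_sum, hmean, inner_zero_right]
  have hexp (k : ι) : w k * ‖v + (y - s k)‖ ^ 2 = w k * ‖v‖ ^ 2
      + 2 * (w k * inner ℝ v (y - s k)) + w k * ‖s k - y‖ ^ 2 := by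
    rw [norm_add_sq_real, norm_sub_rev (s k) y]
    ring
  simp_rw [hexp, sum_add_distrib, ← mul_sum, hinner, ← sum_mul, hw1] at hlt
  linarith

/-- Rounding barycenters one at a time: the squared error is at most the sum of the
individual bounds. -/
theorem exists_norm_sum_sub_sq_le {E κ : Type*} [NormedAddCommGroup E]
    [DecidableEq κ] (S : κ → Set E) (y : κ → E) (b : κ → ℝ) (hne : ∀ i, (S i).Nonempty)
    (h : ∀ i v, ∃ x ∈ S i, ‖v + (y i - x)‖ ^ 2 ≤ ‖v‖ ^ 2 + b i) (t : Finset κ) :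
    ∃ x : κ → E, (∀ i, x i ∈ S i) ∧ ‖∑ i ∈ t, (y i - x i)‖ ^ 2 ≤ ∑ i ∈ t, b i := by
  induction t using Finset.induction_on with
  | empty => exact ⟨fun i => (hne i).some, fun i => (hne i).some_mem, by simp⟩
  | insert a t ha ih =>
    obtain ⟨x, hx, hle⟩ := ih
    obtain ⟨p, hp, hple⟩ := h a (∑ i ∈ t, (y i - x i))
    refine ⟨Function.update x a p, fun i => ?_, ?_⟩
    · rcases eq_or_ne i a with rfl | hi
      · simpa using hp
      · simpa [hi] using hx i
    · have hcongr : ∑ i ∈ t, (y i - Function.update x a p i) = ∑ i ∈ t, (y i - x i) :=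
        sum_congr rfl fun i hi => by
          rw [Function.update_of_ne (ne_of_mem_of_not_mem hi ha)]
      rw [sum_insert ha, sum_insert ha, hcongr, Function.update_self, add_comm (y a - p)]
      linarith

/-- **Shapley–Folkman lemma**: a point of the convex hull of a Minkowski sum of `n` sets is a
sum of convex combinations of points of the summands which use at most `dim E + n` points in
total. -/
theorem exists_barycenters_of_mem_convexHull_sum.{u} {E : Type u} [AddCommGroup E] [Module ℝ E]
    [FiniteDimensional ℝ E] {n : ℕ} (hn : 0 < n) (S : Fin n → Set E) (c : E)
    (hc : c ∈ convexHull ℝ {s : E | ∃ f : Fin n → E, (∀ i, f i ∈ S i) ∧ s = ∑ i, f i}) :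
    ∃ (ι : Type u) (_ : Fintype ι) (g : ι → Fin n) (s : ι → E) (w : ι → ℝ),
      (∀ k, s k ∈ S (g k)) ∧ (∀ k, 0 < w k) ∧ (∀ i, ∑ k with g k = i, w k = 1) ∧
      ∑ k, w k • s k = c ∧ Fintype.card ι ≤ Module.finrank ℝ E + n := by
  classical
  have hn' : (n : ℝ) ≠ 0 := by exact_mod_cast hn.ne'
  let T : Set (E × (Fin n → ℝ)) := {p | ∃ i, p.1 ∈ S i ∧ p.2 = Pi.single i 1}
  have hlift : ((n : ℝ)⁻¹ • c, fun _ : Fin n => (n : ℝ)⁻¹) ∈ convexHull ℝ T := by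
    have hsub : convexHull ℝ {s : E | ∃ f : Fin n → E, (∀ i, f i ∈ S i) ∧ s = ∑ i, f i} ⊆
        {c | ((n : ℝ)⁻¹ • c, fun _ : Fin n => (n : ℝ)⁻¹) ∈ convexHull ℝ T} := by
      refine convexHull_min ?_ ?_
      · rintro _ ⟨f, hf, rfl⟩
        have : ((n : ℝ)⁻¹ • ∑ i, f i, fun _ : Fin n => (n : ℝ)⁻¹)
            = ∑ i, (n : ℝ)⁻¹ • (f i, (Pi.single i 1 : Fin n → ℝ)) := by
          ext1
          · simp [Prod.fst_sum, smul_sum]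
          · ext j
            simp [Prod.snd_sum, Finset.sum_apply, Pi.single_apply]
        rw [Set.mem_ofPred_eq, this]
        refine (convex_convexHull ℝ T).sum_mem (fun _ _ => by positivity) (by simp [hn'])
          fun i _ => subset_convexHull ℝ T ⟨i, hf i, rfl⟩
      · intro a ha b hb α β hα hβ hαβ
        have := convex_convexHull ℝ T ha hb hα hβ hαβ
        rw [Set.mem_ofPred_eq]
        convert this using 1
        ext1
        · simp [smul_smul, mul_comm]
        · ext j
          simp [← add_mul, hαβ]
    exact hsub hc
  obtain ⟨ι, _, z, w, hz, hind, hw, hw1, hsum⟩ := eq_pos_convex_span_of_mem_convexHull hlift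
  choose g hg1 hg2 using fun k => hz (Set.mem_range_self k)
  refine ⟨ι, inferInstance, g, fun k => (z k).1, fun k => n * w k, hg1,
    fun k => mul_pos (by exact_mod_cast hn) (hw k), fun i => ?_, ?_, ?_⟩
  · have h := congrFun (congrArg Prod.snd hsum) i
    simp only [Prod.snd_sum, Finset.sum_apply, Prod.smul_snd, Pi.smul_apply, hg2, smul_eq_mul,
      Pi.single_apply, mul_ite, mul_one, mul_zero] at h
    rw [← mul_sum, sum_filter]
    simp_rw [eq_comm (b := i), h]
    exact mul_inv_cancel₀ hn'
  · have h := congrArg Prod.fst hsum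
    simp only [Prod.fst_sum, Prod.smul_fst] at h
    simp_rw [mul_smul, ← smul_sum]
    rw [h, smul_smul, mul_inv_cancel₀ hn', one_smul]
  · let φ : (E × (Fin n → ℝ)) →ₗ[ℝ] ℝ :=
      (∑ i, LinearMap.proj i) ∘ₗ LinearMap.snd ℝ E (Fin n → ℝ)
    have hφz (k : ι) : φ (z k) = 1 := by simp [φ, hg2]
    have hle : vectorSpan ℝ (Set.range z) ≤ LinearMap.ker φ := by
      rw [vectorSpan_def, Submodule.span_le]
      rintro _ ⟨_, ⟨j, rfl⟩, _, ⟨k, rfl⟩, rfl⟩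
      simp [hφz]
    have hker : LinearMap.ker φ < ⊤ := by
      rw [lt_top_iff_ne_top, Ne, LinearMap.ker_eq_top]
      intro h
      have := LinearMap.congr_fun h (0, Pi.single ⟨0, hn⟩ 1)
      simp [φ] at this
    have h1 := hind.card_le_finrank_succ
    have h2 := Submodule.finrank_mono hle
    have h3 := Submodule.finrank_lt hker.ne
    rw [Module.finrank_prod, Module.finrank_fin_fun] at h3
    omega


/-- **Improved Shapley–Folkman bound** (Budish et al. 2020, Theorem 3.1): if `S₁, …, Sₙ` are
nonempty compact subsets of `ℝ^m` with maximum Euclidean diameter `D`, and `c` lies in the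
convex hull of the Minkowski sum `S₁ + ⋯ + Sₙ`, then there are points `xᵢ ∈ Sᵢ` with
`‖c - ∑ᵢ xᵢ‖₂ ≤ D·√m/2`. -/
theorem improved_shapley_folkman
    (m n : ℕ)
    (S : Fin n → Set (EuclideanSpace ℝ (Fin m)))
    (hne : ∀ i, (S i).Nonempty)
    (hcpt : ∀ i, IsCompact (S i))
    (c : EuclideanSpace ℝ (Fin m))
    (hc : c ∈ convexHull ℝ
      {s : EuclideanSpace ℝ (Fin m) |
        ∃ f : Fin n → EuclideanSpace ℝ (Fin m), (∀ i, f i ∈ S i) ∧ s = ∑ i, f i}) :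
    ∃ x : Fin n → EuclideanSpace ℝ (Fin m),
      (∀ i, x i ∈ S i) ∧
      ‖c - ∑ i, x i‖ ≤ (⨆ i, Metric.diam (S i)) * Real.sqrt (m : ℝ) / 2 := by
  classical
  rcases Nat.eq_zero_or_pos n with rfl | hn
  · refine ⟨0, fun i => i.elim0, ?_⟩
    have : c = 0 := by simpa using hc
    simp [this]
  set D := ⨆ i, Metric.diam (S i)
  have hD (i : Fin n) : Metric.diam (S i) ≤ D := 
    le_ciSup (f := fun i => Metric.diam (S i)) (Set.finite_range _).bddAbove i
  have hD0 : 0 ≤ D := Metric.diam_nonneg.trans (hD ⟨0, hn⟩)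
  obtain ⟨ι, _, g, s, w, hs, hw, hw1, hsum, hcard⟩ :=
    exists_barycenters_of_mem_convexHull_sum hn S c hc
  let F (i : Fin n) : Finset ι := {k | g k = i}
  have hF {i : Fin n} {k : ι} (hk : k ∈ F i) : s k ∈ S i := by
    have := hs k
    rwa [(mem_filter.mp hk).2] at this
  obtain ⟨x, hx, hle⟩ := exists_norm_sum_sub_sq_le S (fun i => ∑ k ∈ F i, w k • s k)
    (fun i => D ^ 2 / 4 * ((#(F i) : ℝ) - 1)) hne (fun i v => by
      obtain ⟨k, hk, hkle⟩ := exists_norm_add_barycenter_sub_sq_le (F i) w s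
        (fun k _ => hw k) (hw1 i) v
      have hvar := weighted_variance_le (F i) w s D (fun k _ => (hw k).le) (hw1 i)
        fun j hj k hk => by
          rw [← dist_eq_norm]
          exact (Metric.dist_le_diam_of_mem (hcpt i).isBounded (hF hj) (hF hk)).trans (hD i)
      exact ⟨s k, hF hk, by linarith⟩) univ
  refine ⟨x, hx, ?_⟩
  have hfib : ∑ i, ∑ k ∈ F i, w k • s k = c := by
    rw [← hsum]
    exact sum_fiberwise univ g fun k => w k • s k
  have hcardF : ∑ i, (#(F i) : ℝ) = Fintype.card ι := by
    rw [← Nat.cast_sum, ← card_eq_sum_card_fiberwise (fun _ _ => mem_coe.mpr (mem_univ _)),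
      card_univ]
  rw [finrank_euclideanSpace_fin] at hcard
  have hcard' : (Fintype.card ι : ℝ) ≤ m + n := by exact_mod_cast hcard
  rw [sum_sub_distrib, hfib, ← mul_sum, sum_sub_distrib, hcardF] at hle
  simp only [sum_const, card_univ, Fintype.card_fin, nsmul_eq_mul, mul_one] at hle
  refine le_of_sq_le_sq ?_ (by positivity)
  calc _ ≤ D ^ 2 / 4 * (Fintype.card ι - n) := hle
    _ ≤ D ^ 2 / 4 * m := by gcongr; linarith
    _ = _ := by rw [div_pow, mul_pow, Real.sq_sqrt (Nat.cast_nonneg m)]; ring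
end
end

section
/- (Implementation of feasible random allocations over near-feasible deterministic allocations.) Let Ψ_1,…,Ψ_n be finite subsets of ℕ^m, each element of each Ψ_i having coordinate sum at most Δ, let c ∈ ℕ^m, and let x̃_i be a finitely supported probability distribution on Ψ_i for each i with Σ_{i=1}^n E[x̃_i] ≤ c coordinatewise, where E[x̃_i] = Σ_{x ∈ Ψ_i} x̃_i(x)·x. Then there exists a finitely supported probability distribution π on Ψ_1 × ⋯ × Ψ_n whose i-th marginal equals x̃_i for every i, and such that every profile (x_1,…,x_n) in the support of π satisfies Σ_{i=1}^n x_i ≤ c + (Δ−1)·1 coordinatewise, where 1 is the all-ones vector in ℕ^m. -/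
open Finset
open scoped Classical

noncomputable section

/-- A profile `z` of lotteries, the `i`-th one on the finite set `Ψ i`. -/
structure IsLotteryProfile {n m : ℕ} (Ψ : Fin n → Finset (Bundle m))
    (z : Fin n → Bundle m → ℝ) : Prop where
  nonneg : ∀ i x, 0 ≤ z i x
  eq_zero : ∀ i x, x ∉ Ψ i → z i x = 0
  sum_eq_one : ∀ i, ∑ x ∈ Ψ i, z i x = 1

/-- A lottery `π` on `∏ i, Ψ i` with marginals `z`, supported on allocations using at most
`b j` units of each good `j`. -/
structure IsImplementation {n m : ℕ} (Ψ : Fin n → Finset (Bundle m)) (b : Fin m → ℕ)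
    (z : Fin n → Bundle m → ℝ) (π : (Fin n → Bundle m) → ℝ) : Prop where
  nonneg : ∀ f, 0 ≤ π f
  eq_zero : ∀ f, f ∉ Fintype.piFinset Ψ → π f = 0
  sum_eq_one : ∑ f ∈ Fintype.piFinset Ψ, π f = 1
  marginal : ∀ i, ∀ x ∈ Ψ i, ∑ f ∈ (Fintype.piFinset Ψ).filter (fun f => f i = x), π f = z i x
  feasible : ∀ f : Fin n → Bundle m, 0 < π f → ∀ j, ∑ i, f i j ≤ b j

/-- Implementations are closed under convex combinations. -/
theorem IsImplementation.convexCombination {n m : ℕ} {Ψ : Fin n → Finset (Bundle m)}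
    {b : Fin m → ℕ} {z z₁ z₂ : Fin n → Bundle m → ℝ} {π₁ π₂ : (Fin n → Bundle m) → ℝ}
    (h₁ : IsImplementation Ψ b z₁ π₁) (h₂ : IsImplementation Ψ b z₂ π₂)
    {s t : ℝ} (hs : 0 ≤ s) (ht : 0 ≤ t) (hst : s + t = 1)
    (hz : ∀ i x, z i x = s * z₁ i x + t * z₂ i x) :
    IsImplementation Ψ b z (fun f => s * π₁ f + t * π₂ f) where
  nonneg f := add_nonneg (mul_nonneg hs (h₁.nonneg f)) (mul_nonneg ht (h₂.nonneg f))
  eq_zero f hf := by simp [h₁.eq_zero f hf, h₂.eq_zero f hf]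
  sum_eq_one := by
    rw [sum_add_distrib, ← mul_sum, ← mul_sum, h₁.sum_eq_one, h₂.sum_eq_one]
    linarith
  marginal i x hx := by
    rw [sum_add_distrib, ← mul_sum, ← mul_sum, h₁.marginal i x hx, h₂.marginal i x hx, hz]
  feasible f hf := by
    rcases (h₁.nonneg f).eq_or_lt with h | h
    · rcases (h₂.nonneg f).eq_or_lt with h' | h'
      · simp [← h, ← h'] at hf
      · exact h₂.feasible f h'
    · exact h₁.feasible f h

/-- The product lottery implements `z` as soon as all allocations it charges are feasible. -/
theorem IsLotteryProfile.isImplementation_prod {n m : ℕ} {Ψ : Fin n → Finset (Bundle m)}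
    {b : Fin m → ℕ} {z : Fin n → Bundle m → ℝ} (hz : IsLotteryProfile Ψ z)
    (hb : ∀ f : Fin n → Bundle m, (∀ i, 0 < z i (f i)) → ∀ j, ∑ i, f i j ≤ b j) :
    IsImplementation Ψ b z (fun f => ∏ i, z i (f i)) where
  nonneg f := prod_nonneg fun i _ => hz.nonneg i _
  eq_zero f hf := by
    obtain ⟨i, hi⟩ : ∃ i, f i ∉ Ψ i := by simpa using hf
    exact prod_eq_zero (mem_univ i) (hz.eq_zero i _ hi)
  sum_eq_one := by
    rw [← prod_univ_sum]
    exact prod_eq_one fun i _ => hz.sum_eq_one i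
  marginal i x hx := by
    rw [← Fintype.piFinset_update_singleton_eq_filter_piFinset_eq Ψ i hx, ← prod_univ_sum,
      prod_eq_single i]
    · simp
    · intro k _ hk
      rw [Function.update_of_ne hk, hz.sum_eq_one]
    · simp
  feasible f hf := by
    refine hb f fun i => (hz.nonneg i _).lt_of_ne fun h => ?_
    exact hf.ne' (prod_eq_zero (mem_univ i) h.symm)

/-- The counting argument of iterated rounding: if every constraint `j` still has slack
at least `Δ` with respect to rounding all variables up, there is a nonzero direction
preserving all the constraints. -/
theorem exists_ne_zero_preserving {ι J : Type*} [Fintype ι] [Fintype J] [Nonempty J]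
    {κ : ι → Type*} [∀ i, Fintype (κ i)] {Δ : ℝ} (hΔ : 0 < Δ)
    (z : (Σ i, κ i) → ℝ) (hz : ∀ v, 0 < z v) (hsum : ∀ i, ∑ x, z ⟨i, x⟩ = 1)
    (a : J → (Σ i, κ i) → ℝ) (ha : ∀ v, ∑ j, a j v ≤ Δ)
    (hslack : ∀ j, Δ ≤ ∑ v, (1 - z v) * a j v) :
    ∃ d : (Σ i, κ i) → ℝ, d ≠ 0 ∧ (∀ i, ∑ x, d ⟨i, x⟩ = 0) ∧ ∀ j, ∑ v, d v * a j v = 0 := by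
  by_contra! hcon
  have hz1 : ∀ v, z v ≤ 1 := fun ⟨i, x⟩ => by
    rw [← hsum i]
    exact single_le_sum (f := fun x => z ⟨i, x⟩) (fun y _ => (hz _).le) (mem_univ x)
  let T : ((Σ i, κ i) → ℝ) →ₗ[ℝ] (ι ⊕ J → ℝ) :=
    { toFun := fun d => Sum.elim (fun i => ∑ x, d ⟨i, x⟩) (fun j => ∑ v, d v * a j v)
      map_add' := fun d e => by
        ext (i | j) <;> simp [sum_add_distrib, add_mul]
      map_smul' := fun r d => by
        ext (i | j) <;> simp [mul_sum, mul_assoc] }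
  have hTl : ∀ d i, T d (Sum.inl i) = ∑ x, d ⟨i, x⟩ := fun _ _ => rfl
  have hTr : ∀ d j, T d (Sum.inr j) = ∑ v, d v * a j v := fun _ _ => rfl
  have hinj : Function.Injective T := by
    rw [← LinearMap.ker_eq_bot, LinearMap.ker_eq_bot']
    intro d hd
    by_contra hne
    obtain ⟨j, hj⟩ := hcon d hne fun i => by rw [← hTl, hd]; rfl
    exact hj (by rw [← hTr, hd]; rfl)
  have hle := LinearMap.finrank_le_finrank_of_injective hinj
  simp only [Module.finrank_fintype_fun_eq_card, Fintype.card_sum] at hle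
  have htotal : (Fintype.card J : ℝ) * Δ ≤ ∑ v, (1 - z v) * ∑ j, a j v := by
    calc (Fintype.card J : ℝ) * Δ = ∑ _j : J, Δ := by simp
      _ ≤ ∑ j, ∑ v, (1 - z v) * a j v := sum_le_sum fun j _ => hslack j
      _ = _ := by rw [sum_comm]; simp only [mul_sum]
  have hcount : ∑ v, (1 - z v) * Δ = ((Fintype.card (Σ i, κ i) : ℝ) - Fintype.card ι) * Δ := by
    rw [← sum_mul, sum_sub_distrib, Fintype.sum_sigma z]
    simp [hsum]
  have hterm : ∀ v, (1 - z v) * ∑ j, a j v ≤ (1 - z v) * Δ := fun v =>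
    mul_le_mul_of_nonneg_left (ha v) (by linarith [hz1 v])
  have hge : (Fintype.card J : ℝ) ≤ (Fintype.card (Σ i, κ i) : ℝ) - Fintype.card ι := by
    refine le_of_mul_le_mul_right ?_ hΔ
    rw [← hcount]
    exact htotal.trans (sum_le_sum fun v _ => hterm v)
  have heq : Fintype.card (Σ i, κ i) = Fintype.card ι + Fintype.card J := by
    refine le_antisymm hle ?_
    have : (Fintype.card ι + Fintype.card J : ℝ) ≤ Fintype.card (Σ i, κ i) := by linarith
    exact_mod_cast this
  have hsurj : Function.Surjective T :=
    (LinearMap.injective_iff_surjective_of_finrank_eq_finrank (by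
      simp only [Module.finrank_fintype_fun_eq_card, Fintype.card_sum]; exact heq)).1 hinj
  obtain ⟨d, hd⟩ := hsurj (Sum.elim 0 1)
  have hd0 : ∀ i, ∑ x, d ⟨i, x⟩ = 0 := fun i => by rw [← hTl, hd]; rfl
  have hd1 : ∀ j, ∑ v, d v * a j v = 1 := fun j => by rw [← hTr, hd]; rfl
  have hne : ∑ v, d v * (∑ j, a j v - Δ) ≠ 0 := by
    have h1 : ∑ v, d v * ∑ j, a j v = Fintype.card J := by
      simp only [mul_sum]
      rw [sum_comm]
      simp [hd1]
    have h2 : ∑ v, d v = 0 := by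
      rw [Fintype.sum_sigma]
      simp [hd0]
    simp only [mul_sub]
    rw [sum_sub_distrib, ← sum_mul, h1, h2]
    simp
  obtain ⟨⟨i, x⟩, -, hv⟩ := exists_ne_zero_of_sum_ne_zero hne
  have hzlt : z ⟨i, x⟩ < 1 := by
    refine (hz1 _).lt_of_ne fun h => left_ne_zero_of_mul hv ?_
    rw [← hd0 i]
    refine (Fintype.sum_eq_single (f := fun w : κ i => d ⟨i, w⟩) x fun y hy => ?_).symm
    have hpair : z ⟨i, x⟩ + z ⟨i, y⟩ ≤ ∑ w, z ⟨i, w⟩ := by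
      rw [← sum_pair (f := fun w => z ⟨i, w⟩) hy.symm]
      exact sum_le_univ_sum_of_nonneg fun w => (hz _).le
    linarith [hz ⟨i, y⟩, hsum i]
  have halt : ∑ j, a j ⟨i, x⟩ < Δ :=
    (ha _).lt_of_ne fun h => right_ne_zero_of_mul hv (by rw [h, sub_self])
  have hlt : ∑ v, (1 - z v) * ∑ j, a j v < ∑ v, (1 - z v) * Δ :=
    sum_lt_sum (fun v _ => hterm v)
      ⟨⟨i, x⟩, mem_univ _, mul_lt_mul_of_pos_left halt (by linarith)⟩
  rw [hcount, heq] at hlt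
  push_cast at hlt
  rw [add_sub_cancel_left] at hlt
  linarith

/-- Moving from a positive vector in a direction with a negative entry, one reaches the
boundary of the nonnegative orthant. -/
theorem exists_pos_add_mul_nonneg {α : Type*} (W : Finset α) (z d : α → ℝ)
    (hz : ∀ v ∈ W, 0 < z v) (hd : ∃ v ∈ W, d v < 0) :
    ∃ t > 0, (∀ v ∈ W, 0 ≤ z v + t * d v) ∧ ∃ v ∈ W, z v + t * d v = 0 := by
  obtain ⟨w, hw, hwd⟩ := hd
  obtain ⟨v, hv, hmin⟩ := exists_min_image (W.filter (d · < 0)) (fun v => z v / -d v)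
    ⟨w, mem_filter.2 ⟨hw, hwd⟩⟩
  obtain ⟨hvW, hvd⟩ := mem_filter.1 hv
  have ht : 0 < z v / -d v := div_pos (hz v hvW) (neg_pos.2 hvd)
  refine ⟨_, ht, fun u hu => ?_, v, hvW, ?_⟩
  · rcases le_or_gt 0 (d u) with h | h
    · exact add_nonneg (hz u hu).le (mul_nonneg ht.le h)
    · have := hmin u (mem_filter.2 ⟨hu, h⟩)
      rw [le_div_iff₀ (neg_pos.2 h)] at this
      linarith
  · have := hvd.ne
    field_simp
    ring

/-- The pairs (agent, bundle) of positive probability. -/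
def lotterySupport {n m : ℕ} (Ψ : Fin n → Finset (Bundle m)) (z : Fin n → Bundle m → ℝ) :
    Finset (Σ _ : Fin n, Bundle m) :=
  (univ.sigma Ψ).filter fun v => 0 < z v.1 v.2

theorem IsLotteryProfile.mem_lotterySupport {n m : ℕ} {Ψ : Fin n → Finset (Bundle m)}
    {z : Fin n → Bundle m → ℝ} (hz : IsLotteryProfile Ψ z) {v : Σ _ : Fin n, Bundle m} :
    v ∈ lotterySupport Ψ z ↔ 0 < z v.1 v.2 := by
  simp only [lotterySupport, mem_filter, mem_sigma, mem_univ, true_and, and_iff_right_iff_imp]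
  intro h
  by_contra hv
  exact h.ne' (hz.eq_zero _ _ hv)

/-- Moving a lottery profile in a nonzero direction along its support that preserves
total mass, one reaches a profile of strictly smaller support. -/
theorem IsLotteryProfile.exists_move {n m : ℕ} {Ψ : Fin n → Finset (Bundle m)}
    {z d : Fin n → Bundle m → ℝ} (hz : IsLotteryProfile Ψ z)
    (hd : ∃ i x, d i x ≠ 0) (hd_supp : ∀ i x, ¬ 0 < z i x → d i x = 0)
    (hd_sum : ∀ i, ∑ x ∈ Ψ i, d i x = 0) :
    ∃ t > 0, IsLotteryProfile Ψ (fun i x => z i x + t * d i x) ∧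
      lotterySupport Ψ (fun i x => z i x + t * d i x) ⊂ lotterySupport Ψ z := by
  have hneg : ∃ v ∈ lotterySupport Ψ z, d v.1 v.2 < 0 := by
    obtain ⟨i, x, hix⟩ := hd
    by_contra! hcon
    have hnonneg : ∀ y, 0 ≤ d i y := fun y => by
      by_cases h : 0 < z i y
      · exact hcon ⟨i, y⟩ (hz.mem_lotterySupport.2 h)
      · rw [hd_supp i y h]
    have hx : x ∈ Ψ i := by
      by_contra h
      exact hix (hd_supp i x (by simp [hz.eq_zero i x h]))
    exact hix ((sum_eq_zero_iff_of_nonneg fun y _ => hnonneg y).1 (hd_sum i) x hx)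
  obtain ⟨t, ht, hnonneg, v, hv, hv0⟩ := exists_pos_add_mul_nonneg (lotterySupport Ψ z)
    (fun v => z v.1 v.2) (fun v => d v.1 v.2) (fun v hv => hz.mem_lotterySupport.1 hv) hneg
  have hz' : IsLotteryProfile Ψ (fun i x => z i x + t * d i x) := by
    refine ⟨fun i x => ?_, fun i x hx => ?_, fun i => ?_⟩
    · by_cases h : 0 < z i x
      · exact hnonneg ⟨i, x⟩ (hz.mem_lotterySupport.2 h)
      · simp [hd_supp i x h, hz.nonneg i x]
    · have h := hz.eq_zero i x hx
      simp [h, hd_supp i x (by simp [h])]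
    · rw [sum_add_distrib, ← mul_sum, hd_sum, hz.sum_eq_one]
      simp
  refine ⟨t, ht, hz', ssubset_iff_of_subset (fun u hu => ?_) |>.2 ⟨v, hv, fun h => ?_⟩⟩
  · have hu := hz'.mem_lotterySupport.1 hu
    refine hz.mem_lotterySupport.2 ?_
    by_contra h
    simp only [hd_supp _ _ h, mul_zero, add_zero] at hu
    exact h hu
  · exact (hz'.mem_lotterySupport.1 h).ne' hv0

/-- If no good in `J` is certain to end up within `Δ - 1` units of its capacity, some nonzero
direction along the support of `z` preserves total masses and the usage of goods in `J`. -/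
theorem IsLotteryProfile.exists_direction {n m Δ : ℕ} (hΔ : 0 < Δ) {c : Fin m → ℕ}
    {Ψ : Fin n → Finset (Bundle m)} (hsize : ∀ i, ∀ x ∈ Ψ i, ∑ j, x j ≤ Δ)
    {z : Fin n → Bundle m → ℝ} (hz : IsLotteryProfile Ψ z) {J : Finset (Fin m)}
    (hJ : J.Nonempty)
    (hfeas : ∀ j ∈ J, ∑ i, ∑ x ∈ Ψ i, z i x * (x j : ℝ) ≤ c j)
    (hover : ∀ j ∈ J, ∃ f : Fin n → Bundle m, (∀ i, 0 < z i (f i)) ∧ c j + Δ ≤ ∑ i, f i j) :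
    ∃ d : Fin n → Bundle m → ℝ, (∃ i x, d i x ≠ 0) ∧ (∀ i x, ¬ 0 < z i x → d i x = 0) ∧
      (∀ i, ∑ x ∈ Ψ i, d i x = 0) ∧
      ∀ j ∈ J, ∑ i, ∑ x ∈ Ψ i, d i x * (x j : ℝ) = 0 := by
  let S : Fin n → Finset (Bundle m) := fun i => (Ψ i).filter (0 < z i ·)
  have hS : ∀ {i x}, x ∈ S i ↔ 0 < z i x := fun {i x} => by
    simp only [S, mem_filter, and_iff_right_iff_imp]
    intro h
    by_contra hx
    exact h.ne' (hz.eq_zero _ _ hx)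
  have hsub : ∀ i (g : Bundle m → ℝ), (∀ x, ¬ 0 < z i x → g x = 0) →
      ∑ x ∈ Ψ i, g x = ∑ x : S i, g x := fun i g hg => by
    rw [sum_coe_sort (S i) g]
    refine (sum_subset (filter_subset _ _) fun x _ hx => hg x ?_).symm
    rwa [← hS]
  have hz0 : ∀ i x, ¬ 0 < z i x → z i x = 0 := fun i x h =>
    le_antisymm (not_lt.1 h) (hz.nonneg i x)
  have : Nonempty J := hJ.to_subtype
  obtain ⟨d, hd, hd_sum, hdJ⟩ := exists_ne_zero_preserving (ι := Fin n) (J := J)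
    (κ := fun i => S i) (Δ := Δ) (by exact_mod_cast hΔ) (fun v => z v.1 v.2)
    (fun v => hS.1 v.2.2)
    (fun i => by rw [← hz.sum_eq_one i, hsub i (z i) (hz0 i)])
    (fun j v => ((v.2 : Bundle m) j : ℝ))
    (fun v => by
      have h1 := hsize v.1 v.2 (mem_filter.1 v.2.2).1
      have h2 : ∑ j : J, (v.2 : Bundle m) j ≤ ∑ j, (v.2 : Bundle m) j := by
        rw [sum_coe_sort J (v.2 : Bundle m)]
        exact sum_le_univ_sum_of_nonneg fun _ => Nat.zero_le _
      exact_mod_cast h2.trans h1)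
    (fun j => by
      obtain ⟨f, hf, hle⟩ := hover j j.2
      have h1 : ∑ v : (Σ i, S i), z v.1 v.2 * ((v.2 : Bundle m) j : ℝ) ≤ c j := by
        rw [Fintype.sum_sigma]
        refine le_trans (le_of_eq ?_) (hfeas j j.2)
        refine sum_congr rfl fun i _ => ?_
        rw [hsub i (fun x => z i x * (x j : ℝ)) fun x h => by rw [hz0 i x h, zero_mul]]
      have h2 : ∑ i, (f i j : ℝ) ≤ ∑ v : (Σ i, S i), ((v.2 : Bundle m) j : ℝ) := by
        rw [Fintype.sum_sigma]
        refine sum_le_sum fun i _ => ?_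
        exact single_le_sum (f := fun x : S i => ((x : Bundle m) j : ℝ))
          (fun _ _ => Nat.cast_nonneg _) (mem_univ ⟨f i, hS.2 (hf i)⟩)
      have h3 : (c j + Δ : ℝ) ≤ ∑ i, (f i j : ℝ) := by exact_mod_cast hle
      simp only [sub_mul, one_mul]
      rw [sum_sub_distrib]
      linarith)
  let D : Fin n → Bundle m → ℝ := fun i x => if h : x ∈ S i then d ⟨i, x, h⟩ else 0
  have hD : ∀ i (x : S i), D i x = d ⟨i, x⟩ := fun i x => by simp [D]
  have hD0 : ∀ i x, ¬ 0 < z i x → D i x = 0 := fun i x h => dif_neg (mt hS.1 h)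
  refine ⟨D, ?_, hD0, fun i => ?_, fun j hj => ?_⟩
  · obtain ⟨⟨i, x⟩, hx⟩ := Function.ne_iff.1 hd
    exact ⟨i, x, by rwa [hD]⟩
  · rw [hsub i _ (hD0 i), ← hd_sum i]
    exact sum_congr rfl fun x _ => hD i x
  · rw [← hdJ ⟨j, hj⟩, Fintype.sum_sigma]
    refine sum_congr rfl fun i _ => ?_
    rw [hsub i (fun x => D i x * (x j : ℝ)) fun x h => by rw [hD0 i x h, zero_mul]]
    exact sum_congr rfl fun x _ => by rw [hD]

/-- Iterated rounding: the capacity constraints of the goods in `J` hold in expectation,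
those of the other goods hold for every allocation of positive probability, up to `Δ - 1`. -/
theorem IsLotteryProfile.exists_isImplementation {n m Δ : ℕ} (hΔ : 0 < Δ) {c : Fin m → ℕ}
    {Ψ : Fin n → Finset (Bundle m)} (hsize : ∀ i, ∀ x ∈ Ψ i, ∑ j, x j ≤ Δ)
    {z : Fin n → Bundle m → ℝ} (hz : IsLotteryProfile Ψ z) {J : Finset (Fin m)}
    (hfeas : ∀ j ∈ J, ∑ i, ∑ x ∈ Ψ i, z i x * (x j : ℝ) ≤ c j)
    (hdone : ∀ j ∉ J, ∀ f : Fin n → Bundle m, (∀ i, 0 < z i (f i)) →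
      ∑ i, f i j ≤ c j + (Δ - 1)) :
    ∃ π, IsImplementation Ψ (fun j => c j + (Δ - 1)) z π := by
  induction hN : #(lotterySupport Ψ z) + #J using Nat.strong_induction_on generalizing z J with
  | _ N ih =>
  subst hN
  rcases J.eq_empty_or_nonempty with rfl | hJ
  · exact ⟨_, hz.isImplementation_prod fun f hf j => hdone j (notMem_empty j) f hf⟩
  by_cases hdrop : ∃ j ∈ J, ∀ f : Fin n → Bundle m, (∀ i, 0 < z i (f i)) →
      ∑ i, f i j ≤ c j + (Δ - 1)
  · obtain ⟨j, hj, hjf⟩ := hdrop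
    refine ih _ (Nat.add_lt_add_left (card_erase_lt_of_mem hj) _) hz
      (fun k hk => hfeas k (mem_of_mem_erase hk)) (fun k hk => ?_) rfl
    rcases eq_or_ne k j with rfl | hkj
    · exact hjf
    · exact hdone k fun h => hk (mem_erase.2 ⟨hkj, h⟩)
  push Not at hdrop
  obtain ⟨d, hd, hd_supp, hd_sum, hdJ⟩ := hz.exists_direction hΔ hsize hJ hfeas fun j hj => by
    obtain ⟨f, hf, h⟩ := hdrop j hj
    exact ⟨f, hf, by omega⟩
  have step : ∀ r : ℝ, IsLotteryProfile Ψ (fun i x => z i x + r * d i x) →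
      lotterySupport Ψ (fun i x => z i x + r * d i x) ⊂ lotterySupport Ψ z →
      ∃ π, IsImplementation Ψ (fun j => c j + (Δ - 1)) (fun i x => z i x + r * d i x) π := by
    intro r hz' hss
    refine ih _ (Nat.add_lt_add_right (card_lt_card hss) _) hz' (fun j hj => ?_)
      (fun j hj f hf => hdone j hj f fun i => ?_) rfl
    · simp only [add_mul, mul_assoc, sum_add_distrib, ← mul_sum, hdJ j hj, mul_zero, add_zero]
      exact hfeas j hj
    · exact hz.mem_lotterySupport.1 (hss.1 ((hz'.mem_lotterySupport (v := ⟨i, f i⟩)).2 (hf i)))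
  obtain ⟨s, hs, hzs, hss⟩ := hz.exists_move hd hd_supp hd_sum
  obtain ⟨t, ht, hzt, hst⟩ := hz.exists_move (d := fun i x => -d i x)
    (by simpa using hd) (fun i x h => by simp [hd_supp i x h]) (fun i => by simp [hd_sum])
  simp only [mul_neg, ← neg_mul] at hzt hst
  obtain ⟨π₁, h₁⟩ := step s hzs hss
  obtain ⟨π₂, h₂⟩ := step (-t) hzt hst
  refine ⟨_, h₁.convexCombination h₂ (s := t / (s + t)) (t := s / (s + t))
    (by positivity) (by positivity) (by field_simp; ring) fun i x => ?_⟩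
  field_simp
  ring

/-- **Implementation over near-feasible deterministic allocations** (Nguyen, Peivandi,
Vohra 2016, Theorem 2.1): any profile of lotteries `x̃ᵢ` on finite sets `Ψᵢ ⊆ ℕ^m` of
bundles of size at most `Δ`, whose sum of expectations is at most `c` coordinatewise, is
the profile of marginals of a lottery `π` over deterministic allocations each of which
uses at most `c + (Δ-1)·1` units of the goods. -/
theorem near_feasible_implementation
    (n m Δ : ℕ) (hΔ : 0 < Δ)
    (c : Fin m → ℕ)
    (Ψ : Fin n → Finset (Bundle m))
    (hsize : ∀ i, ∀ x ∈ Ψ i, ∑ j, x j ≤ Δ)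
    (xt : Fin n → Bundle m → ℝ)
    (hx_nonneg : ∀ i x, 0 ≤ xt i x)
    (hx_supp : ∀ i x, x ∉ Ψ i → xt i x = 0)
    (hx_sum : ∀ i, ∑ x ∈ Ψ i, xt i x = 1)
    (hx_feas : ∀ j, ∑ i, ∑ x ∈ Ψ i, xt i x * (x j : ℝ) ≤ (c j : ℝ)) :
    ∃ π : (Fin n → Bundle m) → ℝ,
      (∀ f, 0 ≤ π f) ∧
      (∀ f, f ∉ Fintype.piFinset Ψ → π f = 0) ∧
      (∑ f ∈ Fintype.piFinset Ψ, π f = 1) ∧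
      (∀ i, ∀ x ∈ Ψ i,
        ∑ f ∈ (Fintype.piFinset Ψ).filter (fun f => f i = x), π f = xt i x) ∧
      (∀ f : Fin n → Bundle m, 0 < π f → ∀ j, ∑ i, f i j ≤ c j + (Δ - 1)) := by
  have hz : IsLotteryProfile Ψ xt := ⟨hx_nonneg, hx_supp, hx_sum⟩
  obtain ⟨π, hπ⟩ := hz.exists_isImplementation hΔ hsize (J := univ) (fun j _ => hx_feas j)
    (fun j hj => absurd (mem_univ j) hj)
  exact ⟨π, hπ.nonneg, hπ.eq_zero, hπ.sum_eq_one, hπ.marginal, hπ.feasible⟩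
end
end

section
/- Let (S, ≻) be a finite set equipped with a strict linear order, and let μ and ν be probability distributions on S. Then μ first-order stochastically dominates ν (i.e., for every z ∈ S, Σ_{x ∈ S, x ⪰ z} μ(x) ≥ Σ_{y ∈ S, y ⪰ z} ν(y), where ⪰ means equality-or-≻) if and only if there exists a function λ : S × S → ℝ with λ(x,y) ≥ 0 for all x, y and λ(x,y) = 0 whenever x ⊁ y, such that for every x ∈ S: μ(x) = ν(x) + Σ_{y ∈ S, x ≻ y} λ(x,y) − Σ_{y′ ∈ S, y′ ≻ x} λ(y′, x). In words, μ stochastically dominates ν exactly when μ can be obtained from ν by a collection of nonnegative probability shifts, each moving mass from a less preferred element to a more preferred element. -/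
open Finset

noncomputable section

/-- If every shift moves mass upwards, the mass leaving an upper set is at most the mass
entering it. -/
theorem sum_outflow_le_sum_inflow {S : Type*} [Fintype S] [LinearOrder S] {lam : S → S → ℝ}
    (hnonneg : ∀ x y, 0 ≤ lam x y) (hzero : ∀ x y, ¬ y < x → lam x y = 0) (z : S) :
    ∑ x ∈ univ.filter (fun x => z ≤ x), ∑ y, lam y x ≤
      ∑ x ∈ univ.filter (fun x => z ≤ x), ∑ y, lam x y := by
  rw [sum_comm, ← sum_filter_of_ne (p := fun y => z ≤ y)]
  · exact sum_le_sum fun y _ =>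
      sum_le_sum_of_subset_of_nonneg (filter_subset _ _) fun x _ _ => hnonneg y x
  · intro y _ hy
    by_contra hzy
    refine hy (sum_eq_zero fun x hx => hzero y x fun hxy => hzy ?_)
    exact ((mem_filter.1 hx).2.trans hxy.le)

open Classical in
theorem sum_covBy_below {S : Type*} [Fintype S] [LinearOrder S] (f : S → ℝ)
    (hf : ∀ x, IsMin x → f x = 0) (x : S) :
    ∑ y ∈ univ.filter (fun y => y < x), (if y ⋖ x then f x else 0) = f x := by
  by_cases hx : IsMin x
  · simp [hf x hx]
  · obtain ⟨b, hb⟩ := not_isMin_iff.1 hx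
    obtain ⟨p, -, hp⟩ := exists_le_covBy_of_lt hb
    rw [sum_eq_single_of_mem p (by simpa using hp.lt), if_pos hp]
    exact fun y _ hy => if_neg fun h => hy (h.unique_left hp)

open Classical in
theorem sum_covBy_above {S : Type*} [Fintype S] [LinearOrder S] (d : S → ℝ) (x : S) :
    ∑ y ∈ univ.filter (fun y => x < y),
        (if x ⋖ y then ∑ w ∈ univ.filter (fun w => y ≤ w), d w else 0) =
      ∑ w ∈ univ.filter (fun w => x < w), d w := by
  by_cases hx : IsMax x
  · have : univ.filter (fun w => x < w) = ∅ := filter_eq_empty_iff.2 fun _ _ => hx.not_lt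
    simp [this]
  · obtain ⟨b, hb⟩ := not_isMax_iff.1 hx
    obtain ⟨p, hp, -⟩ := exists_covBy_le_of_lt hb
    rw [sum_eq_single_of_mem p (by simpa using hp.lt), if_pos hp]
    · exact sum_congr (filter_congr fun w _ =>
        ⟨hp.lt.trans_le, fun h => not_lt.1 (hp.2 h)⟩) fun _ _ => rfl
    · exact fun y _ hy => if_neg fun h => hy (h.unique_right hp)

theorem sum_filter_le_eq_add_sum_filter_lt {S : Type*} [Fintype S] [LinearOrder S]
    (d : S → ℝ) (x : S) :
    ∑ w ∈ univ.filter (fun w => x ≤ w), d w =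
      d x + ∑ w ∈ univ.filter (fun w => x < w), d w := by
  rw [← sum_insert (by simp)]
  refine sum_congr ?_ fun _ _ => rfl
  ext w
  simp [le_iff_eq_or_lt, eq_comm]

/-- **Stochastic dominance via probability shifts**: on a finite linearly ordered set
(where `x ≻ y` means `y < x`), `μ` first-order stochastically dominates `ν` if and only if
`μ` is obtained from `ν` by nonnegative probability shifts `λ(x,y)` moving mass from each
less preferred element `y` to a more preferred element `x`. -/
theorem fosd_iff_probability_shifts
    (S : Type) [Fintype S] [LinearOrder S]
    (μ ν : S → ℝ)
    (hμ_nonneg : ∀ x, 0 ≤ μ x) (hν_nonneg : ∀ x, 0 ≤ ν x)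
    (hμ_sum : ∑ x, μ x = 1) (hν_sum : ∑ x, ν x = 1) :
    (∀ z : S,
        ∑ y ∈ Finset.univ.filter (fun y => z ≤ y), ν y ≤
          ∑ x ∈ Finset.univ.filter (fun x => z ≤ x), μ x)
      ↔
    (∃ lam : S → S → ℝ,
        (∀ x y, 0 ≤ lam x y) ∧
        (∀ x y, ¬ y < x → lam x y = 0) ∧
        (∀ x : S, μ x = ν x
          + (∑ y ∈ Finset.univ.filter (fun y => y < x), lam x y)
          - ∑ y' ∈ Finset.univ.filter (fun y' => x < y'), lam y' x)) := by
  classical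
  constructor
  · intro h
    set F : S → ℝ := fun z => ∑ w ∈ univ.filter (fun w => z ≤ w), (μ w - ν w) with hF
    have hF_nonneg (z) : 0 ≤ F z := by simpa [hF, sum_sub_distrib] using h z
    have hF_min (z) (hz : IsMin z) : F z = 0 := by
      have : univ.filter (fun w => z ≤ w) = univ :=
        filter_true_of_mem fun w _ => hz.isBot w
      simp only [hF, this, sum_sub_distrib, hμ_sum, hν_sum, sub_self]
    refine ⟨fun x y => if y ⋖ x then F x else 0, fun x y => ?_,
      fun x y hxy => if_neg fun hc => hxy hc.lt, fun x => ?_⟩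
    · dsimp only
      split_ifs
      exacts [hF_nonneg x, le_rfl]
    · dsimp only
      rw [sum_covBy_below F hF_min, sum_covBy_above]
      have := sum_filter_le_eq_add_sum_filter_lt (fun w => μ w - ν w) x
      simp only [hF]
      linarith
  · rintro ⟨lam, hnonneg, hzero, hshift⟩ z
    have hin (x) : ∑ y ∈ univ.filter (fun y => y < x), lam x y = ∑ y, lam x y :=
      sum_filter_of_ne fun y _ hy => by_contra fun hc => hy (hzero x y hc)
    have hout (x) : ∑ y ∈ univ.filter (fun y => x < y), lam y x = ∑ y, lam y x :=
      sum_filter_of_ne fun y _ hy => by_contra fun hc => hy (hzero y x hc)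
    have hflow := sum_outflow_le_sum_inflow hnonneg hzero z
    rw [sum_congr rfl fun x _ => hshift x]
    simp only [hin, hout, sum_sub_distrib, sum_add_distrib]
    linarith
end
end
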